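/- L^p bound for the directional maximal operator, p > 2: for 2 < p < ∞ there is C_p > 0 such that for N > 10, any weight w on ℝ², and W = M_{Σ_N} M_Q w, ‖M_{Σ_N} f‖_{L^p(ℝ², w)} ≤ C_p (log N)^{1/p} ‖f‖_{L^p(ℝ², W)}. -/

import Mathlib

open MeasureTheory Set Real
open scoped ENNReal

noncomputable section

/-- A cube (square) in the plane with sides parallel to the axes. -/
def IsCube2 (Q : Set (ℝ × ℝ)) : Prop :=
  ∃ a b r : ℝ, 0 < r ∧ Q = Ioo a (a + r) ×ˢ Ioo b (b + r)

/-- The Hardy–Littlewood maximal operator over cubes in the plane. -/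
def MHL2 (f : ℝ × ℝ → ℝ) (x : ℝ × ℝ) : ℝ≥0∞ :=
  ⨆ (Q : Set (ℝ × ℝ)) (_ : IsCube2 Q ∧ x ∈ Q),
    (∫⁻ y in Q, ENNReal.ofReal |f y|) / volume Q

/-- The open rectangle with center `c`, long direction `v`, short side `l` and
long side `L`. -/
def dirRect (v c : ℝ × ℝ) (l L : ℝ) : Set (ℝ × ℝ) :=
  {x | |(x.1 - c.1) * v.1 + (x.2 - c.2) * v.2| < L / 2 ∧
       |(x.2 - c.2) * v.1 - (x.1 - c.1) * v.2| < l / 2}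

/-- The set of `N` uniformly spread unit vectors on the circle. -/
def SigmaN (N : ℕ) : Set (ℝ × ℝ) :=
  {v | ∃ j < N, v = (Real.cos (2 * π * j / N), Real.sin (2 * π * j / N))}

/-- Rectangles whose longest side is parallel to a direction in `Σ_N`. -/
def IsDirRect (N : ℕ) (R : Set (ℝ × ℝ)) : Prop :=
  ∃ v ∈ SigmaN N, ∃ c : ℝ × ℝ, ∃ l L : ℝ, 0 < l ∧ l ≤ L ∧ R = dirRect v c l L

/-- The directional maximal operator associated with `Σ_N`. -/
def MSig (N : ℕ) (f : ℝ × ℝ → ℝ) (x : ℝ × ℝ) : ℝ≥0∞ :=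
  ⨆ (R : Set (ℝ × ℝ)) (_ : IsDirRect N R ∧ x ∈ R),
    (∫⁻ y in R, ENNReal.ofReal |f y|) / volume R

/-- The directional maximal operator acting on `ℝ≥0∞`-valued functions. -/
def MSigE (N : ℕ) (g : ℝ × ℝ → ℝ≥0∞) (x : ℝ × ℝ) : ℝ≥0∞ :=
  ⨆ (R : Set (ℝ × ℝ)) (_ : IsDirRect N R ∧ x ∈ R),
    (∫⁻ y in R, g y) / volume R

section BasisMax

variable {α : Type*} [MeasurableSpace α]

/-- The maximal operator, with respect to the measure `m`, over the sets satisfying `B`. -/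
def basisMax (m : Measure α) (B : Set α → Prop) (g : α → ℝ≥0∞) (x : α) : ℝ≥0∞ :=
  ⨆ (R : Set α) (_ : B R ∧ x ∈ R), (∫⁻ y in R, g y ∂m) / m R

theorem lt_basisMax_iff {m : Measure α} {B : Set α → Prop} {g : α → ℝ≥0∞} {x : α} {t : ℝ≥0∞} :
    t < basisMax m B g x ↔ ∃ R, (B R ∧ x ∈ R) ∧ t < (∫⁻ y in R, g y ∂m) / m R := by
  simp only [basisMax, lt_iSup_iff, exists_prop]

theorem le_basisMax {m : Measure α} {B : Set α → Prop} {g : α → ℝ≥0∞} {x : α} {R : Set α}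
    (hB : B R) (hx : x ∈ R) : (∫⁻ y in R, g y ∂m) / m R ≤ basisMax m B g x :=
  le_iSup₂_of_le (f := fun (R : Set α) (_ : B R ∧ x ∈ R) ↦ (∫⁻ y in R, g y ∂m) / m R)
    R ⟨hB, hx⟩ le_rfl

theorem basisMax_le {m : Measure α} {B : Set α → Prop} {g : α → ℝ≥0∞} {x : α} {M : ℝ≥0∞}
    (h : ∀ R, B R → x ∈ R → (∫⁻ y in R, g y ∂m) / m R ≤ M) : basisMax m B g x ≤ M :=
  iSup₂_le fun R hR ↦ h R hR.1 hR.2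

theorem basisMax_mono {m : Measure α} {B : Set α → Prop} {g h : α → ℝ≥0∞} (hgh : g ≤ h) :
    basisMax m B g ≤ basisMax m B h :=
  fun _ ↦ iSup₂_mono fun _ _ ↦ ENNReal.div_le_div_right (lintegral_mono hgh) _

theorem basisMax_le_of_le {m : Measure α} {B : Set α → Prop} {g : α → ℝ≥0∞} {M : ℝ≥0∞}
    (hg : ∀ x, g x ≤ M) (x : α) : basisMax m B g x ≤ M := by
  refine basisMax_le fun R _ _ ↦ ENNReal.div_le_of_le_mul ?_
  calc ∫⁻ y in R, g y ∂m ≤ ∫⁻ _ in R, M ∂m := lintegral_mono hg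
    _ = M * m R := by simp

theorem setOf_lt_basisMax_eq {m : Measure α} {B : Set α → Prop} {g : α → ℝ≥0∞} {t : ℝ≥0∞} :
    {x | t < basisMax m B g x} = ⋃₀ {R | B R ∧ t < (∫⁻ y in R, g y ∂m) / m R} := by
  ext x
  simp only [mem_ofPred_eq, lt_basisMax_iff, mem_sUnion]
  exact ⟨fun ⟨R, ⟨h1, h2⟩, h3⟩ ↦ ⟨R, ⟨h1, h3⟩, h2⟩, fun ⟨R, ⟨h1, h3⟩, h2⟩ ↦ ⟨R, ⟨h1, h2⟩, h3⟩⟩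

/-- Truncation: the part of `g` below the level `t` contributes at most `t` to the maximal
function. -/
theorem lt_basisMax_indicator {m : Measure α} {B : Set α → Prop} {g : α → ℝ≥0∞}
    {s t : ℝ≥0∞} {x : α} (hx : s + t < basisMax m B g x) :
    s < basisMax m B ({y | t < g y}.indicator g) x := by
  by_contra! h
  refine hx.not_ge (basisMax_le fun R hR hxR ↦ ?_)
  have hle : ∀ y, g y ≤ {y | t < g y}.indicator g y + t := by
    intro y
    by_cases hy : t < g y
    · rw [indicator_of_mem (by exact hy)]; exact le_self_add
    · rw [indicator_of_notMem (by exact hy), zero_add]; exact not_lt.1 hy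
  calc (∫⁻ y in R, g y ∂m) / m R
      ≤ (∫⁻ y in R, ({y | t < g y}.indicator g y + t) ∂m) / m R :=
        ENNReal.div_le_div_right (lintegral_mono hle) _
    _ = (∫⁻ y in R, {y | t < g y}.indicator g y ∂m) / m R + t * m R / m R := by
        rw [lintegral_add_right _ measurable_const, setLIntegral_const, ENNReal.add_div]
    _ ≤ s + t := add_le_add ((le_basisMax hR hxR).trans h) (ENNReal.div_le_of_le_mul le_rfl)

variable [TopologicalSpace α]

theorem isOpen_setOf_lt_basisMax {m : Measure α} {B : Set α → Prop} (hB : ∀ R, B R → IsOpen R)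
    (g : α → ℝ≥0∞) (t : ℝ≥0∞) : IsOpen {x | t < basisMax m B g x} := by
  rw [setOf_lt_basisMax_eq]
  exact isOpen_sUnion fun R hR ↦ hB R hR.1

theorem lowerSemicontinuous_basisMax {m : Measure α} {B : Set α → Prop}
    (hB : ∀ R, B R → IsOpen R) (g : α → ℝ≥0∞) : LowerSemicontinuous (basisMax m B g) :=
  lowerSemicontinuous_iff_isOpen_preimage.2 fun t ↦ isOpen_setOf_lt_basisMax hB g t

theorem measurable_basisMax [OpensMeasurableSpace α] {m : Measure α} {B : Set α → Prop}
    (hB : ∀ R, B R → IsOpen R) (g : α → ℝ≥0∞) : Measurable (basisMax m B g) :=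
  (lowerSemicontinuous_basisMax hB g).measurable

/-- A bound for the finite unions of the sets on which the average is large bounds the
superlevel set of the maximal function. -/
theorem measure_lt_basisMax_le [SecondCountableTopology α]
    {m μ : Measure α} {B : Set α → Prop} (hB : ∀ R, B R → IsOpen R) {g : α → ℝ≥0∞}
    {t M : ℝ≥0∞}
    (h : ∀ (n : ℕ) (R : ℕ → Set α), (∀ i < n, B (R i) ∧ t < (∫⁻ y in R i, g y ∂m) / m (R i)) →
      μ (⋃ i ∈ Finset.range n, R i) ≤ M) :
    μ {x | t < basisMax m B g x} ≤ M := by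
  rw [setOf_lt_basisMax_eq]
  set S := {R | B R ∧ t < (∫⁻ y in R, g y ∂m) / m R}
  obtain ⟨T, hTc, hTS, hTU⟩ := TopologicalSpace.isOpen_sUnion_countable S fun R hR ↦ hB R hR.1
  rw [← hTU]
  rcases T.eq_empty_or_nonempty with rfl | hne
  · simp
  obtain ⟨R, rfl⟩ := hTc.exists_eq_range hne
  rw [sUnion_range, measure_iUnion_eq_iSup_accumulate]
  refine iSup_le fun n ↦ ?_
  refine le_trans (measure_mono ?_) (h (n + 1) R fun i _ ↦ hTS ⟨i, rfl⟩)
  intro x hx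
  simp only [mem_accumulate] at hx
  obtain ⟨i, hi, hx⟩ := hx
  exact mem_biUnion (Finset.mem_coe.2 (Finset.mem_range.2 (Nat.lt_succ_of_le hi))) hx

end BasisMax

section Interpolation

theorem lintegral_ofReal_rpow_lt {s : ℝ} (hs : 0 < s) (u : ℝ≥0∞) :
    ∫⁻ t in Ioi (0 : ℝ), (if ENNReal.ofReal t < u then ENNReal.ofReal (t ^ (s - 1)) else 0)
      = u ^ s / ENNReal.ofReal s := by
  have key : ∀ x : ℝ, 0 ≤ x → ∫⁻ t in Ioi (0 : ℝ),
      (if ENNReal.ofReal t < ENNReal.ofReal x then ENNReal.ofReal (t ^ (s - 1)) else 0)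
      = ENNReal.ofReal x ^ s / ENNReal.ofReal s := by
    intro x hx
    have h1 : ∫⁻ t in Ioi (0 : ℝ),
        (if ENNReal.ofReal t < ENNReal.ofReal x then ENNReal.ofReal (t ^ (s - 1)) else 0)
        = ∫⁻ t in Ioi (0 : ℝ), (Iio x).indicator (fun t ↦ ENNReal.ofReal (t ^ (s - 1))) t := by
      refine setLIntegral_congr_fun measurableSet_Ioi fun t ht ↦ ?_
      have ht' : (0 : ℝ) ≤ t := le_of_lt ht
      simp only [indicator, mem_Iio]
      congr 1
      rw [ENNReal.ofReal_lt_ofReal_iff_of_nonneg ht']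
    rw [h1, lintegral_indicator measurableSet_Iio, Measure.restrict_restrict measurableSet_Iio]
    have h2 : Iio x ∩ Ioi (0 : ℝ) = Ioo 0 x := by ext; simp [and_comm]
    have h3 : IntervalIntegrable (fun t : ℝ ↦ t ^ (s - 1)) volume 0 x :=
      intervalIntegral.intervalIntegrable_rpow' (by linarith)
    rw [h2, Measure.restrict_congr_set Ioo_ae_eq_Ioc, ← ofReal_integral_eq_lintegral_ofReal,
      ← intervalIntegral.integral_of_le hx, integral_rpow (Or.inl (by linarith))]
    · rw [sub_add_cancel, Real.zero_rpow hs.ne', sub_zero, ENNReal.ofReal_div_of_pos hs,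
        ENNReal.ofReal_rpow_of_nonneg hx hs.le]
    · exact (intervalIntegrable_iff_integrableOn_Ioc_of_le hx).1 h3
    · filter_upwards [ae_restrict_mem measurableSet_Ioc] with t ht
      exact Real.rpow_nonneg ht.1.le _
  rcases eq_or_ne u ⊤ with rfl | hu
  · rw [ENNReal.top_rpow_of_pos hs, ENNReal.top_div_of_ne_top ENNReal.ofReal_ne_top]
    refine ENNReal.eq_top_of_forall_nnreal_le fun r ↦ ?_
    set x : ℝ := (r * s) ^ (1 / s) with hx
    have hx0 : 0 ≤ x := by positivity
    have := key x hx0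
    have h4 : ENNReal.ofReal x ^ s / ENNReal.ofReal s = r := by
      rw [ENNReal.ofReal_rpow_of_nonneg hx0 hs.le, ← ENNReal.ofReal_div_of_pos hs, hx,
        ← Real.rpow_mul (by positivity), one_div_mul_cancel hs.ne', Real.rpow_one,
        mul_div_cancel_right₀ _ hs.ne', ENNReal.ofReal_coe_nnreal]
    rw [← h4, ← this]
    refine lintegral_mono fun t ↦ ?_
    by_cases ht : ENNReal.ofReal t < ENNReal.ofReal x
    · simp [ht]
    · simp [ht]
  · rw [← ENNReal.ofReal_toReal hu]
    exact key _ ENNReal.toReal_nonneg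

variable {α : Type*} [MeasurableSpace α]

theorem lintegral_rpow_eq_lintegral_meas {μ : Measure α} [SFinite μ] {F : α → ℝ≥0∞}
    (hF : Measurable F) {r : ℝ} (hr : 0 < r) :
    ∫⁻ x, F x ^ r ∂μ = ENNReal.ofReal r *
      ∫⁻ t in Ioi (0 : ℝ), ENNReal.ofReal (t ^ (r - 1)) * μ {x | ENNReal.ofReal t < F x} := by
  have hr0 : ENNReal.ofReal r ≠ 0 := by simpa using hr
  have h1 : ∀ x, F x ^ r = ENNReal.ofReal r * ∫⁻ t in Ioi (0 : ℝ),
      (if ENNReal.ofReal t < F x then ENNReal.ofReal (t ^ (r - 1)) else 0) := by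
    intro x
    rw [lintegral_ofReal_rpow_lt hr, ENNReal.mul_div_cancel hr0 ENNReal.ofReal_ne_top]
  have hset : MeasurableSet {z : α × ℝ | ENNReal.ofReal z.2 < F z.1} :=
    measurableSet_lt (ENNReal.measurable_ofReal.comp measurable_snd) (hF.comp measurable_fst)
  have hm : Measurable (Function.uncurry fun (x : α) (t : ℝ) ↦
      if ENNReal.ofReal t < F x then ENNReal.ofReal (t ^ (r - 1)) else 0) :=
    Measurable.ite hset (by fun_prop) measurable_const
  simp_rw [h1]
  rw [lintegral_const_mul' _ _ ENNReal.ofReal_ne_top, lintegral_lintegral_swap hm.aemeasurable]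
  congr 1
  refine lintegral_congr fun t ↦ ?_
  rw [← setLIntegral_const, ← lintegral_indicator]
  · simp only [indicator, mem_ofPred_eq]
  · exact measurableSet_lt measurable_const hF

/-- A weak type bound on the truncations of `h` gives a strong type bound. -/
theorem lintegral_rpow_le_of_weak {β : Type*} [MeasurableSpace β] {μ : Measure α} {ν : Measure β}
    [SFinite μ] [SFinite ν] {F : α → ℝ≥0∞} {h : β → ℝ≥0∞} (hF : Measurable F) (hh : Measurable h)
    {a r : ℝ} (ha : 0 < a) (har : a < r) {K : ℝ≥0∞} (hK : K ≠ ⊤)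
    (hw : ∀ t : ℝ, 0 < t → ENNReal.ofReal (t ^ a) * μ {x | ENNReal.ofReal t < F x} ≤
      K * ∫⁻ x, (if ENNReal.ofReal t < 2 * h x then h x ^ a else 0) ∂ν) :
    ∫⁻ x, F x ^ r ∂μ ≤
      K * ENNReal.ofReal (r / (r - a) * 2 ^ (r - a)) * ∫⁻ x, h x ^ r ∂ν := by
  have hr : 0 < r := ha.trans har
  have hra : 0 < r - a := by linarith
  have hset : MeasurableSet {z : β × ℝ | ENNReal.ofReal z.2 < 2 * h z.1} :=
    measurableSet_lt (ENNReal.measurable_ofReal.comp measurable_snd)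
      ((hh.comp measurable_fst).const_mul 2)
  have hm : Measurable (Function.uncurry fun (t : ℝ) (x : β) ↦ ENNReal.ofReal (t ^ (r - a - 1)) *
      (if ENNReal.ofReal t < 2 * h x then h x ^ a else 0)) := by
    refine Measurable.mul (by fun_prop) (Measurable.ite ?_ (by fun_prop) measurable_const)
    exact measurable_swap hset
  have h2 : (2 : ℝ≥0∞) = ENNReal.ofReal 2 := by simp
  rw [lintegral_rpow_eq_lintegral_meas hF hr]
  calc ENNReal.ofReal r *
      ∫⁻ t in Ioi (0 : ℝ), ENNReal.ofReal (t ^ (r - 1)) * μ {x | ENNReal.ofReal t < F x}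
      ≤ ENNReal.ofReal r * ∫⁻ t in Ioi (0 : ℝ), K * ∫⁻ x, ENNReal.ofReal (t ^ (r - a - 1)) *
          (if ENNReal.ofReal t < 2 * h x then h x ^ a else 0) ∂ν := by
        gcongr 1
        refine setLIntegral_mono' measurableSet_Ioi fun t ht ↦ ?_
        have ht : (0 : ℝ) < t := ht
        have he : t ^ (r - 1) = t ^ (r - a - 1) * t ^ a := by
          rw [← Real.rpow_add ht]; congr 1; ring
        rw [he, ENNReal.ofReal_mul (by positivity), mul_assoc,
          lintegral_const_mul' _ _ ENNReal.ofReal_ne_top, ← mul_assoc K, mul_comm K, mul_assoc]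
        exact mul_le_mul_right (hw t ht) _
    _ = ENNReal.ofReal r * (K * ∫⁻ x, h x ^ a * ((2 * h x) ^ (r - a) / ENNReal.ofReal (r - a)) ∂ν) := by
        rw [lintegral_const_mul' _ _ hK, lintegral_lintegral_swap hm.aemeasurable]
        congr 2
        refine lintegral_congr fun x ↦ ?_
        rw [← lintegral_ofReal_rpow_lt hra, ← lintegral_const_mul]
        · refine lintegral_congr fun t ↦ ?_
          by_cases hc : ENNReal.ofReal t < 2 * h x
          · simp [mul_comm]
          · simp [hc]
        · exact Measurable.ite (measurableSet_lt (by fun_prop) measurable_const) (by fun_prop)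
            measurable_const
    _ = K * ENNReal.ofReal (r / (r - a) * 2 ^ (r - a)) * ∫⁻ x, h x ^ r ∂ν := by
        have : ∀ x, h x ^ a * ((2 * h x) ^ (r - a) / ENNReal.ofReal (r - a))
            = ENNReal.ofReal (2 ^ (r - a) / (r - a)) * h x ^ r := by
          intro x
          rw [ENNReal.mul_rpow_of_nonneg _ _ hra.le, ENNReal.ofReal_div_of_pos hra,
            ← ENNReal.ofReal_rpow_of_nonneg (by norm_num) hra.le, ← h2]
          have : h x ^ r = h x ^ a * h x ^ (r - a) := by
            rw [← ENNReal.rpow_add_of_nonneg _ _ ha.le hra.le]; congr 1; ring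
          rw [this, div_eq_mul_inv, div_eq_mul_inv]
          ring
        simp_rw [this]
        rw [lintegral_const_mul' _ _ ENNReal.ofReal_ne_top, div_mul_eq_mul_div, mul_div_assoc,
          ENNReal.ofReal_mul hr.le]
        ring

/-- Interpolation between a weak type `(a, a)` bound and the trivial `L^∞` bound. -/
theorem lintegral_basisMax_rpow_le [TopologicalSpace α] [OpensMeasurableSpace α]
    {m μ ν : Measure α} [SFinite μ] [SFinite ν]
    {B : Set α → Prop} (hB : ∀ R, B R → IsOpen R) {a r : ℝ} (ha : 0 < a) (har : a < r)
    {K : ℝ≥0∞} (hK : K ≠ ⊤)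
    (hw : ∀ (g : α → ℝ≥0∞), Measurable g → ∀ t : ℝ, 0 < t →
      ENNReal.ofReal (t ^ a) * μ {x | ENNReal.ofReal t < basisMax m B g x} ≤
        K * ∫⁻ x, g x ^ a ∂ν) {h : α → ℝ≥0∞} (hh : Measurable h) :
    ∫⁻ x, basisMax m B h x ^ r ∂μ ≤
      K * ENNReal.ofReal (r / (r - a) * 2 ^ r) * ∫⁻ x, h x ^ r ∂ν := by
  have hra : 0 < r - a := by linarith
  have h2a : (0 : ℝ) ≤ 2 ^ a := by positivity
  have key := lintegral_rpow_le_of_weak (μ := μ) (ν := ν) (F := basisMax m B h) (h := h)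
    (measurable_basisMax hB h) hh ha har (K := ENNReal.ofReal (2 ^ a) * K)
    (ENNReal.mul_ne_top ENNReal.ofReal_ne_top hK) ?_
  · refine key.trans_eq ?_
    rw [mul_comm (ENNReal.ofReal (2 ^ a)) K, mul_assoc K, ← ENNReal.ofReal_mul h2a]
    congr 3
    have : (2 : ℝ) ^ r = 2 ^ a * 2 ^ (r - a) := by
      rw [← Real.rpow_add (by norm_num)]; congr 1; ring
    rw [this]; ring
  · intro t ht
    have ht2 : 0 < t / 2 := by positivity
    have hsum : ENNReal.ofReal t = ENNReal.ofReal (t / 2) + ENNReal.ofReal (t / 2) := by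
      rw [← ENNReal.ofReal_add ht2.le ht2.le, add_halves]
    have hlt : ∀ y, ENNReal.ofReal t < 2 * h y ↔ ENNReal.ofReal (t / 2) < h y := by
      intro y
      rw [hsum, ← two_mul]
      exact ENNReal.mul_lt_mul_iff_right (by norm_num) (by norm_num)
    set g := {y | ENNReal.ofReal (t / 2) < h y}.indicator h
    have hg : Measurable g := hh.indicator (measurableSet_lt measurable_const hh)
    have he : ∀ x, (if ENNReal.ofReal t < 2 * h x then h x ^ a else 0) = g x ^ a := by
      intro x
      simp only [hlt, g, indicator, mem_ofPred_eq]
      split_ifs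
      · rfl
      · rw [ENNReal.zero_rpow_of_pos ha]
    simp_rw [he]
    have hsplit : t ^ a = 2 ^ a * (t / 2) ^ a := by
      rw [← Real.mul_rpow (by norm_num) ht2.le]; congr 1; ring
    calc ENNReal.ofReal (t ^ a) * μ {x | ENNReal.ofReal t < basisMax m B h x}
        ≤ ENNReal.ofReal (2 ^ a) * (ENNReal.ofReal ((t / 2) ^ a) *
            μ {x | ENNReal.ofReal (t / 2) < basisMax m B g x}) := by
          rw [hsplit, ENNReal.ofReal_mul h2a, mul_assoc]
          refine mul_le_mul_right (mul_le_mul_right (measure_mono fun x hx ↦ ?_) _) _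
          rw [mem_ofPred_eq, hsum] at hx
          exact lt_basisMax_indicator hx
      _ ≤ ENNReal.ofReal (2 ^ a) * (K * ∫⁻ x, g x ^ a ∂ν) := by
          exact mul_le_mul_right (hw g hg _ ht2) _
      _ = _ := by ring

end Interpolation

section FeffermanStein

theorem IsCube2.isOpen {Q : Set (ℝ × ℝ)} (h : IsCube2 Q) : IsOpen Q := by
  obtain ⟨a, b, r, _, rfl⟩ := h
  exact isOpen_Ioo.prod isOpen_Ioo

theorem volume_Ioo_prod_Ioo (a b c d : ℝ) :
    volume (Ioo a b ×ˢ Ioo c d : Set (ℝ × ℝ)) = ENNReal.ofReal (b - a) * ENNReal.ofReal (d - c) := by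
  rw [Measure.volume_eq_prod, Measure.prod_prod, Real.volume_Ioo, Real.volume_Ioo]

theorem measure_enlarged_cube_le {w : ℝ × ℝ → ℝ≥0∞} {g : ℝ × ℝ → ℝ≥0∞} {t : ℝ≥0∞} {a b r : ℝ}
    (hr : 0 < r) (ht : t ≤ (∫⁻ y in Ioo a (a + r) ×ˢ Ioo b (b + r), g y) /
      volume (Ioo a (a + r) ×ˢ Ioo b (b + r) : Set (ℝ × ℝ))) :
    t * ∫⁻ y in Ioo (a - 2 * r) (a + 3 * r) ×ˢ Ioo (b - 2 * r) (b + 3 * r), w y ≤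
      25 * ∫⁻ y in Ioo a (a + r) ×ˢ Ioo b (b + r), g y * basisMax volume IsCube2 w y := by
  set Q : Set (ℝ × ℝ) := Ioo a (a + r) ×ˢ Ioo b (b + r) with hQ
  set P : Set (ℝ × ℝ) := Ioo (a - 2 * r) (a + 3 * r) ×ˢ Ioo (b - 2 * r) (b + 3 * r) with hP
  have hP' : IsCube2 P := ⟨a - 2 * r, b - 2 * r, 5 * r, by positivity, by rw [hP]; ring_nf⟩
  have hQm : MeasurableSet Q := measurableSet_Ioo.prod measurableSet_Ioo
  have hQP : Q ⊆ P := prod_mono (Ioo_subset_Ioo (by linarith) (by linarith))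
    (Ioo_subset_Ioo (by linarith) (by linarith))
  have hQv : volume Q = ENNReal.ofReal (r * r) := by
    rw [hQ, volume_Ioo_prod_Ioo, ← ENNReal.ofReal_mul (by linarith)]; ring_nf
  have hPv : volume P = 25 * ENNReal.ofReal (r * r) := by
    have : (25 : ℝ≥0∞) = ENNReal.ofReal 25 := by simp
    rw [hP, volume_Ioo_prod_Ioo, ← ENNReal.ofReal_mul (by linarith), this,
      ← ENNReal.ofReal_mul (by norm_num)]
    ring_nf
  have hv0 : ENNReal.ofReal (r * r) ≠ 0 := by simpa using mul_pos hr hr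
  have h1 : t * volume Q ≤ ∫⁻ y in Q, g y := ENNReal.mul_le_of_le_div ht
  set A := (∫⁻ y in P, w y) / volume P with hA
  have hA25 : ∫⁻ y in P, w y = A * (25 * ENNReal.ofReal (r * r)) := by
    rw [hA, hPv, ENNReal.div_mul_cancel]
    · simpa using mul_pos hr hr
    · finiteness
  calc t * ∫⁻ y in P, w y = 25 * (A * (t * volume Q)) := by rw [hA25, hQv]; ring
    _ ≤ 25 * (A * ∫⁻ y in Q, g y) := by gcongr
    _ ≤ 25 * ∫⁻ y in Q, A * g y := by gcongr; exact lintegral_const_mul_le _ _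
    _ ≤ _ := by
      gcongr 1
      refine setLIntegral_mono' hQm fun y hy ↦ ?_
      rw [mul_comm]
      gcongr
      exact le_basisMax hP' (hQP hy)

/-- The Fefferman–Stein weak type inequality for the maximal operator over squares. -/
theorem feffermanStein_weak {w g : ℝ × ℝ → ℝ≥0∞} (t : ℝ≥0∞) (ht0 : t ≠ 0) (htT : t ≠ ⊤) :
    t * ∫⁻ y in {x | t < basisMax volume IsCube2 g x}, w y ≤
      25 * ∫⁻ y, g y * basisMax volume IsCube2 w y := by
  rw [mul_comm, ← ENNReal.le_div_iff_mul_le (Or.inl ht0) (Or.inl htT),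
    ← withDensity_apply _ (isOpen_setOf_lt_basisMax (fun R hR ↦ hR.isOpen) g t).measurableSet]
  refine measure_lt_basisMax_le (fun R hR ↦ hR.isOpen) fun n R hR ↦ ?_
  rw [ENNReal.le_div_iff_mul_le (Or.inl ht0) (Or.inl htT), mul_comm]
  have hcube : ∀ i, ∃ a b r : ℝ, i < n → 0 < r ∧ R i = Ioo a (a + r) ×ˢ Ioo b (b + r) := by
    intro i
    by_cases hi : i < n
    · obtain ⟨a, b, r, h⟩ := (hR i hi).1
      exact ⟨a, b, r, fun _ ↦ h⟩
    · exact ⟨0, 0, 0, fun h ↦ absurd h hi⟩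
  choose a b r hr using hcube
  have hne : ∀ i ∈ {i | i < n}, (R i).Nonempty := by
    intro i hi
    obtain ⟨h1, h2⟩ := hr i hi
    rw [h2]
    exact (nonempty_Ioo.2 (by linarith)).prod (nonempty_Ioo.2 (by linarith))
  obtain ⟨u, hut, hud, huc⟩ := Vitali.exists_disjoint_subfamily_covering_enlargement R {i | i < n}
    r 2 one_lt_two (fun i hi ↦ (hr i hi).1.le) (∑ i ∈ Finset.range n, |r i|)
    (fun i hi ↦ (le_abs_self _).trans
      (Finset.single_le_sum (f := fun i ↦ |r i|) (fun _ _ ↦ abs_nonneg _)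
        (Finset.mem_range.2 hi))) hne
  have hufin : u.Finite := (finite_lt_nat n).subset hut
  set s := hufin.toFinset
  have hs : ∀ {i}, i ∈ s ↔ i ∈ u := by simp [s]
  set P : ℕ → Set (ℝ × ℝ) := fun i ↦
    Ioo (a i - 2 * r i) (a i + 3 * r i) ×ˢ Ioo (b i - 2 * r i) (b i + 3 * r i) with hP
  have hcover : (⋃ i ∈ Finset.range n, R i) ⊆ ⋃ i ∈ s, P i := by
    refine iUnion₂_subset fun i hi x hx ↦ ?_
    have hi : i < n := Finset.mem_range.1 hi
    obtain ⟨j, hj, ⟨z, hzi, hzj⟩, hij⟩ := huc i hi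
    refine mem_biUnion (hs.2 hj) ?_
    have hri := (hr i hi).1
    rw [(hr i hi).2] at hx hzi
    rw [(hr j (hut hj)).2] at hzj
    simp only [mem_prod, mem_Ioo] at hx hzi hzj
    simp only [hP, mem_prod, mem_Ioo]
    refine ⟨⟨?_, ?_⟩, ?_, ?_⟩ <;> linarith [hx.1.1, hx.1.2, hx.2.1, hx.2.2, hzi.1.1, hzi.1.2,
      hzi.2.1, hzi.2.2, hzj.1.1, hzj.1.2, hzj.2.1, hzj.2.2]
  have hRm : ∀ i ∈ s, MeasurableSet (R i) := fun i hi ↦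
    (hR i (hut (hs.1 hi))).1.isOpen.measurableSet
  calc t * volume.withDensity w (⋃ i ∈ Finset.range n, R i)
      ≤ t * ∑ i ∈ s, volume.withDensity w (P i) := by
        gcongr
        exact (measure_mono hcover).trans (measure_biUnion_finset_le _ _)
    _ = ∑ i ∈ s, t * ∫⁻ y in P i, w y := by
        rw [Finset.mul_sum]
        refine Finset.sum_congr rfl fun i _ ↦ ?_
        rw [withDensity_apply _ (measurableSet_Ioo.prod measurableSet_Ioo)]
    _ ≤ ∑ i ∈ s, 25 * ∫⁻ y in R i, g y * basisMax volume IsCube2 w y := by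
        refine Finset.sum_le_sum fun i hi ↦ ?_
        have hin := hut (hs.1 hi)
        have h3 := (hR i hin).2.le
        rw [(hr i hin).2] at h3 ⊢
        exact measure_enlarged_cube_le (hr i hin).1 h3
    _ = 25 * ∫⁻ y in ⋃ i ∈ s, R i, g y * basisMax volume IsCube2 w y := by
        rw [← Finset.mul_sum, lintegral_biUnion_finset (fun i hi j hj hij ↦
          hud (hs.1 hi) (hs.1 hj) hij) hRm]
    _ ≤ _ := by
        gcongr
        exact Measure.restrict_le_self

/-- The Fefferman–Stein inequality for the maximal operator over squares. -/
theorem feffermanStein_strong {w h : ℝ × ℝ → ℝ≥0∞} (hw : Measurable w) (hh : Measurable h)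
    {r : ℝ} (hr : 1 < r) :
    ∫⁻ x, basisMax volume IsCube2 h x ^ r * w x ≤
      25 * ENNReal.ofReal (r / (r - 1) * 2 ^ r) *
        ∫⁻ x, h x ^ r * basisMax volume IsCube2 w x := by
  have hB : ∀ R : Set (ℝ × ℝ), IsCube2 R → IsOpen R := fun R hR ↦ hR.isOpen
  have hM := measurable_basisMax (m := volume) hB w
  have key := lintegral_basisMax_rpow_le (m := volume) (μ := volume.withDensity w)
    (ν := volume.withDensity (basisMax volume IsCube2 w)) hB one_pos hr (K := 25)
    (by norm_num) (fun g hg t ht ↦ ?_) hh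
  · rw [lintegral_withDensity_eq_lintegral_mul _ hw ((measurable_basisMax hB h).pow_const r),
      lintegral_withDensity_eq_lintegral_mul _ hM (hh.pow_const r)] at key
    simpa only [Pi.mul_apply, mul_comm (w _), mul_comm (basisMax _ _ w _)] using key
  · rw [withDensity_apply _ (isOpen_setOf_lt_basisMax hB g _).measurableSet,
      lintegral_withDensity_eq_lintegral_mul _ hM (hg.pow_const 1), Real.rpow_one]
    refine (feffermanStein_weak _ (by simpa using ht) ENNReal.ofReal_ne_top).trans_eq ?_
    simp [mul_comm]

end FeffermanStein

section OneDimensional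

/-- A finite family of intervals has a subfamily with the same union and overlap at most two. -/
theorem exists_subfamily_Ioo_overlap_le_two {ι : Type*} [DecidableEq ι] (s : Finset ι)
    (a b : ι → ℝ) :
    ∃ u ⊆ s, (⋃ i ∈ s, Ioo (a i) (b i)) ⊆ ⋃ i ∈ u, Ioo (a i) (b i) ∧
      ∀ x, (u.filter fun i ↦ x ∈ Ioo (a i) (b i)).card ≤ 2 := by
  classical
  set P : Finset (Finset ι) := s.powerset.filter fun u ↦
    (⋃ i ∈ s, Ioo (a i) (b i)) ⊆ ⋃ i ∈ u, Ioo (a i) (b i)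
  obtain ⟨u, huP, hmin⟩ := P.exists_min_image Finset.card
    ⟨s, Finset.mem_filter.2 ⟨Finset.mem_powerset_self s, subset_rfl⟩⟩
  obtain ⟨hus, hcov⟩ := Finset.mem_filter.1 huP
  rw [Finset.mem_powerset] at hus
  refine ⟨u, hus, hcov, fun x ↦ ?_⟩
  by_contra! hx
  set v := u.filter fun i ↦ x ∈ Ioo (a i) (b i) with hv
  have hvne : v.Nonempty := Finset.card_pos.1 (by omega)
  obtain ⟨i, hi, himin⟩ := v.exists_min_image a hvne
  obtain ⟨j, hj, hjmax⟩ := v.exists_max_image b hvne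
  obtain ⟨k, hk, hkij⟩ : ∃ k ∈ v, k ∉ ({i, j} : Finset ι) :=
    Finset.exists_mem_notMem_of_card_lt_card (Finset.card_le_two.trans_lt hx)
  simp only [Finset.mem_insert, Finset.mem_singleton, not_or] at hkij
  have hmem : ∀ {l}, l ∈ v → l ∈ u ∧ x ∈ Ioo (a l) (b l) := fun h ↦ Finset.mem_filter.1 h
  have herase : u.erase k ∈ P := by
    refine Finset.mem_filter.2 ⟨Finset.mem_powerset.2 ((Finset.erase_subset _ _).trans hus),
      hcov.trans (iUnion₂_subset fun l hl y hy ↦ ?_)⟩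
    rcases eq_or_ne l k with rfl | hlk
    · rcases le_or_gt y x with hyx | hxy
      · exact mem_biUnion (Finset.mem_coe.2 (Finset.mem_erase.2 ⟨Ne.symm hkij.1, (hmem hi).1⟩))
          ⟨(himin l hk).trans_lt hy.1, hyx.trans_lt (hmem hi).2.2⟩
      · exact mem_biUnion (Finset.mem_coe.2 (Finset.mem_erase.2 ⟨Ne.symm hkij.2, (hmem hj).1⟩))
          ⟨(hmem hj).2.1.trans hxy, hy.2.trans_le (hjmax l hk)⟩
    · exact mem_biUnion (Finset.mem_coe.2 (Finset.mem_erase.2 ⟨hlk, hl⟩)) hy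
  have h1 := hmin _ herase
  have h2 := Finset.card_erase_lt_of_mem (hmem hk).1
  omega

/-- The weak type bound for maximal operators over intervals, for an arbitrary measure. -/
theorem basisMax_Ioo_weak {σ : Measure ℝ} {B : Set ℝ → Prop}
    (hB : ∀ R, B R → ∃ a b, R = Ioo a b) {f : ℝ → ℝ≥0∞} (hf : Measurable f)
    (t : ℝ≥0∞) (ht0 : t ≠ 0) (htT : t ≠ ⊤) :
    t * σ {x | t < basisMax σ B f x} ≤ 2 * ∫⁻ y, f y ∂σ := by
  rw [mul_comm, ← ENNReal.le_div_iff_mul_le (Or.inl ht0) (Or.inl htT)]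
  refine measure_lt_basisMax_le (fun R hR ↦ ?_) fun n R hR ↦ ?_
  · obtain ⟨a, b, rfl⟩ := hB R hR
    exact isOpen_Ioo
  rw [ENNReal.le_div_iff_mul_le (Or.inl ht0) (Or.inl htT), mul_comm]
  have h_ioo : ∀ i, ∃ a b : ℝ, i < n → R i = Ioo a b := by
    intro i
    by_cases hi : i < n
    · obtain ⟨a, b, h⟩ := hB _ (hR i hi).1
      exact ⟨a, b, fun _ ↦ h⟩
    · exact ⟨0, 0, fun h ↦ absurd h hi⟩
  choose a b hab using h_ioo
  obtain ⟨u, hus, hcov, hover⟩ := exists_subfamily_Ioo_overlap_le_two (Finset.range n) a b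
  have hlt : ∀ {i}, i ∈ u → i < n := fun hi ↦ Finset.mem_range.1 (hus hi)
  have hcov' : (⋃ i ∈ Finset.range n, R i) ⊆ ⋃ i ∈ u, R i := by
    intro x hx
    have hx' : x ∈ ⋃ i ∈ Finset.range n, Ioo (a i) (b i) := by
      simp only [mem_iUnion, Finset.mem_range, exists_prop] at hx ⊢
      obtain ⟨i, hi, hx⟩ := hx
      exact ⟨i, hi, hab i hi ▸ hx⟩
    have := hcov hx'
    simp only [mem_iUnion, exists_prop] at this ⊢
    obtain ⟨i, hi, hx⟩ := this
    exact ⟨i, hi, (hab i (hlt hi)).symm ▸ hx⟩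
  calc t * σ (⋃ i ∈ Finset.range n, R i)
      ≤ t * ∑ i ∈ u, σ (R i) := by
        gcongr
        exact (measure_mono hcov').trans (measure_biUnion_finset_le _ _)
    _ = ∑ i ∈ u, t * σ (R i) := Finset.mul_sum _ _ _
    _ ≤ ∑ i ∈ u, ∫⁻ y, (Ioo (a i) (b i)).indicator f y ∂σ := by
        refine Finset.sum_le_sum fun i hi ↦ ?_
        rw [lintegral_indicator measurableSet_Ioo, ← hab i (hlt hi)]
        exact ENNReal.mul_le_of_le_div (hR i (hlt hi)).2.le
    _ = ∫⁻ y, ∑ i ∈ u, (Ioo (a i) (b i)).indicator f y ∂σ :=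
        (lintegral_finsetSum _ fun i _ ↦ hf.indicator measurableSet_Ioo).symm
    _ ≤ ∫⁻ y, 2 * f y ∂σ := by
        refine lintegral_mono fun y ↦ ?_
        simp only [indicator_apply]
        rw [← Finset.sum_filter, Finset.sum_const, nsmul_eq_mul]
        gcongr
        exact_mod_cast hover y
    _ = 2 * ∫⁻ y, f y ∂σ := lintegral_const_mul _ hf

theorem basisMax_Ioo_strong {σ : Measure ℝ} [SFinite σ] {B : Set ℝ → Prop}
    (hB : ∀ R, B R → ∃ a b, R = Ioo a b) {f : ℝ → ℝ≥0∞} (hf : Measurable f)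
    {r : ℝ} (hr : 1 < r) :
    ∫⁻ x, basisMax σ B f x ^ r ∂σ ≤
      2 * ENNReal.ofReal (r / (r - 1) * 2 ^ r) * ∫⁻ x, f x ^ r ∂σ := by
  refine lintegral_basisMax_rpow_le (fun R hR ↦ ?_) one_pos hr (by norm_num)
    (fun g hg t ht ↦ ?_) hf
  · obtain ⟨a, b, rfl⟩ := hB R hR
    exact isOpen_Ioo
  · simpa using basisMax_Ioo_weak hB hg _ (by simpa using ht) ENNReal.ofReal_ne_top

end OneDimensional

section Frame

/-- Coordinates along `u` and perpendicular to `u`. -/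
def frame (u z : ℝ × ℝ) : ℝ × ℝ := (z.1 * u.1 + z.2 * u.2, z.2 * u.1 - z.1 * u.2)

/-- The inverse of `frame u` for a unit vector `u`. -/
def unframe (u z : ℝ × ℝ) : ℝ × ℝ := (z.1 * u.1 - z.2 * u.2, z.1 * u.2 + z.2 * u.1)

theorem continuous_frame (u : ℝ × ℝ) : Continuous (frame u) := by unfold frame; fun_prop

theorem continuous_unframe (u : ℝ × ℝ) : Continuous (unframe u) := by unfold unframe; fun_prop

theorem unframe_frame {u : ℝ × ℝ} (hu : u.1 ^ 2 + u.2 ^ 2 = 1) (z : ℝ × ℝ) :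
    unframe u (frame u z) = z := by
  ext
  · simp only [unframe, frame]; linear_combination z.1 * hu
  · simp only [unframe, frame]; linear_combination z.2 * hu

theorem frame_unframe {u : ℝ × ℝ} (hu : u.1 ^ 2 + u.2 ^ 2 = 1) (z : ℝ × ℝ) :
    frame u (unframe u z) = z := by
  ext
  · simp only [unframe, frame]; linear_combination z.1 * hu
  · simp only [unframe, frame]; linear_combination z.2 * hu

/-- `frame u` as a measurable equivalence. -/
def frameEquiv {u : ℝ × ℝ} (hu : u.1 ^ 2 + u.2 ^ 2 = 1) : ℝ × ℝ ≃ᵐ ℝ × ℝ where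
  toFun := frame u
  invFun := unframe u
  left_inv := unframe_frame hu
  right_inv := frame_unframe hu
  measurable_toFun := (continuous_frame u).measurable
  measurable_invFun := (continuous_unframe u).measurable

theorem measurePreserving_frame {u : ℝ × ℝ} (hu : u.1 ^ 2 + u.2 ^ 2 = 1) :
    MeasurePreserving (frame u) volume volume := by
  refine ⟨(continuous_frame u).measurable, ?_⟩
  set M : Matrix (Fin 2) (Fin 2) ℝ := !![u.1, u.2; -u.2, u.1] with hM
  set f : (ℝ × ℝ) →ₗ[ℝ] ℝ × ℝ :=
    Matrix.toLin (Module.Basis.finTwoProd ℝ) (Module.Basis.finTwoProd ℝ) M with hf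
  have hfun : (f : ℝ × ℝ → ℝ × ℝ) = frame u := by
    funext z
    rw [hf, hM, Matrix.toLin_finTwoProd]
    simp [frame]
    constructor <;> ring
  have hdet : LinearMap.det f = 1 := by
    rw [hf, LinearMap.det_toLin, hM, Matrix.det_fin_two_of]
    linear_combination hu
  have := Measure.map_linearMap_addHaar_eq_smul_addHaar (volume : Measure (ℝ × ℝ))
    (f := f) (by rw [hdet]; norm_num)
  rw [hdet, hfun] at this
  simpa using this

theorem measurableEmbedding_frame {u : ℝ × ℝ} (hu : u.1 ^ 2 + u.2 ^ 2 = 1) :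
    MeasurableEmbedding (frame u) := (frameEquiv hu).measurableEmbedding

theorem setLIntegral_frame {u : ℝ × ℝ} (hu : u.1 ^ 2 + u.2 ^ 2 = 1) (G : ℝ × ℝ → ℝ≥0∞)
    (T : Set (ℝ × ℝ)) : ∫⁻ z in frame u ⁻¹' T, G (frame u z) = ∫⁻ z in T, G z :=
  (measurePreserving_frame hu).setLIntegral_comp_preimage_emb (measurableEmbedding_frame hu) G T

theorem lintegral_frame {u : ℝ × ℝ} (hu : u.1 ^ 2 + u.2 ^ 2 = 1) (G : ℝ × ℝ → ℝ≥0∞) :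
    ∫⁻ z, G (frame u z) = ∫⁻ z, G z :=
  (measurePreserving_frame hu).lintegral_comp_emb (measurableEmbedding_frame hu) G

theorem setLIntegral_unframe {u : ℝ × ℝ} (hu : u.1 ^ 2 + u.2 ^ 2 = 1) (G : ℝ × ℝ → ℝ≥0∞)
    (T : Set (ℝ × ℝ)) : ∫⁻ z in frame u ⁻¹' T, G z = ∫⁻ z in T, G (unframe u z) := by
  rw [← setLIntegral_frame hu (fun z ↦ G (unframe u z))]
  simp_rw [unframe_frame hu]

theorem dirRect_eq_preimage (u c : ℝ × ℝ) (l L : ℝ) :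
    dirRect u c l L = frame u ⁻¹' (Ioo ((frame u c).1 - L / 2) ((frame u c).1 + L / 2) ×ˢ
      Ioo ((frame u c).2 - l / 2) ((frame u c).2 + l / 2)) := by
  ext z
  simp only [dirRect, frame, mem_ofPred_eq, mem_preimage, mem_prod, mem_Ioo, abs_lt]
  constructor
  · rintro ⟨⟨h1, h2⟩, h3, h4⟩
    refine ⟨⟨?_, ?_⟩, ?_, ?_⟩ <;> linarith
  · rintro ⟨⟨h1, h2⟩, h3, h4⟩
    refine ⟨⟨?_, ?_⟩, ?_, ?_⟩ <;> linarith

theorem isOpen_dirRect (u c : ℝ × ℝ) (l L : ℝ) : IsOpen (dirRect u c l L) := by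
  rw [dirRect_eq_preimage]
  exact (isOpen_Ioo.prod isOpen_Ioo).preimage (continuous_frame u)

theorem volume_dirRect {u : ℝ × ℝ} (hu : u.1 ^ 2 + u.2 ^ 2 = 1) (c : ℝ × ℝ) (l L : ℝ) :
    volume (dirRect u c l L) = ENNReal.ofReal L * ENNReal.ofReal l := by
  rw [dirRect_eq_preimage, (measurePreserving_frame hu).measure_preimage
    (measurableSet_Ioo.prod measurableSet_Ioo).nullMeasurableSet, volume_Ioo_prod_Ioo]
  congr 2 <;> ring

/-- The integral over a set contained in a rotated square is controlled by the maximal operator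
over axis-parallel squares. -/
theorem setLIntegral_le_basisMax_frame {u : ℝ × ℝ} (hu : u.1 ^ 2 + u.2 ^ 2 = 1)
    {y : ℝ × ℝ} {ρ : ℝ} (hρ : 0 < ρ) {T : Set (ℝ × ℝ)}
    (hT : ∀ z ∈ T, |z.1 - (frame u y).1| < ρ ∧ |z.2 - (frame u y).2| < ρ) (G : ℝ × ℝ → ℝ≥0∞) :
    ∫⁻ z in T, G z ≤
      ENNReal.ofReal (16 * ρ ^ 2) * basisMax volume IsCube2 (fun z ↦ G (frame u z)) y := by
  have h1 : |u.1| ≤ 1 := abs_le.2 ⟨by nlinarith, by nlinarith⟩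
  have h2 : |u.2| ≤ 1 := abs_le.2 ⟨by nlinarith, by nlinarith⟩
  set Q : Set (ℝ × ℝ) := Ioo (y.1 - 2 * ρ) (y.1 - 2 * ρ + 4 * ρ) ×ˢ
    Ioo (y.2 - 2 * ρ) (y.2 - 2 * ρ + 4 * ρ) with hQ
  have hQc : IsCube2 Q := ⟨_, _, 4 * ρ, by positivity, rfl⟩
  have hyQ : y ∈ Q := by
    simp only [hQ, mem_prod, mem_Ioo]
    refine ⟨⟨?_, ?_⟩, ?_, ?_⟩ <;> linarith
  have hv : volume Q = ENNReal.ofReal (16 * ρ ^ 2) := by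
    rw [hQ, volume_Ioo_prod_Ioo, ← ENNReal.ofReal_mul (by linarith)]
    ring_nf
  have hsub : frame u ⁻¹' T ⊆ Q := by
    intro z hz
    obtain ⟨hs, ht⟩ := hT _ hz
    have e1 : z.1 - y.1 = ((frame u z).1 - (frame u y).1) * u.1 -
        ((frame u z).2 - (frame u y).2) * u.2 := by
      simp only [frame]; linear_combination -(z.1 - y.1) * hu
    have e2 : z.2 - y.2 = ((frame u z).1 - (frame u y).1) * u.2 +
        ((frame u z).2 - (frame u y).2) * u.1 := by
      simp only [frame]; linear_combination -(z.2 - y.2) * hu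
    set p := (frame u z).1 - (frame u y).1
    set q := (frame u z).2 - (frame u y).2
    have key : ∀ c d : ℝ, |c| < ρ → |d| ≤ 1 → |c * d| < ρ := fun c d hc hd ↦ by
      rw [abs_mul]
      exact (mul_le_of_le_one_right (abs_nonneg c) hd).trans_lt hc
    have k1 := abs_lt.1 (key p u.1 hs h1)
    have k2 := abs_lt.1 (key q u.2 ht h2)
    have k3 := abs_lt.1 (key p u.2 hs h2)
    have k4 := abs_lt.1 (key q u.1 ht h1)
    simp only [hQ, mem_prod, mem_Ioo]
    refine ⟨⟨?_, ?_⟩, ?_, ?_⟩ <;> linarith [k1.1, k1.2, k2.1, k2.2, k3.1, k3.2, k4.1, k4.2]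
  have hv0 : ENNReal.ofReal (16 * ρ ^ 2) ≠ 0 := by
    rw [Ne, ENNReal.ofReal_eq_zero]; push Not; positivity
  calc ∫⁻ z in T, G z = ∫⁻ z in frame u ⁻¹' T, G (frame u z) := (setLIntegral_frame hu G T).symm
    _ ≤ ∫⁻ z in Q, G (frame u z) := lintegral_mono_set hsub
    _ = volume Q * ((∫⁻ z in Q, G (frame u z)) / volume Q) := by
        rw [ENNReal.mul_div_cancel] <;> rw [hv]
        · exact hv0
        · exact ENNReal.ofReal_ne_top
    _ ≤ _ := by
        rw [← hv]
        gcongr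
        exact le_basisMax hQc hyQ

end Frame

section LineAverage

theorem norm_sq_of_mem_SigmaN {N : ℕ} {e : ℝ × ℝ} (he : e ∈ SigmaN N) : e.1 ^ 2 + e.2 ^ 2 = 1 := by
  obtain ⟨j, _, rfl⟩ := he
  exact Real.cos_sq_add_sin_sq _

theorem IsDirRect.isOpen {N : ℕ} {R : Set (ℝ × ℝ)} (h : IsDirRect N R) : IsOpen R := by
  obtain ⟨v, _, c, l, L, _, _, rfl⟩ := h
  exact isOpen_dirRect v c l L

theorem isDirRect_preimage {N : ℕ} {e : ℝ × ℝ} (he : e ∈ SigmaN N) {a b c d : ℝ}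
    (hcd : c < d) (h : d - c ≤ b - a) : IsDirRect N (frame e ⁻¹' (Ioo a b ×ˢ Ioo c d)) := by
  refine ⟨e, he, unframe e ((a + b) / 2, (c + d) / 2), d - c, b - a, by linarith, h, ?_⟩
  rw [dirRect_eq_preimage, frame_unframe (norm_sq_of_mem_SigmaN he)]
  congr 3 <;> ring

theorem lowerSemicontinuousAt_lintegral_section {g : ℝ × ℝ → ℝ≥0∞} (hg : LowerSemicontinuous g)
    (μ : Measure ℝ) (t₀ : ℝ) : LowerSemicontinuousAt (fun t ↦ ∫⁻ s, g (s, t) ∂μ) t₀ := by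
  intro c hc
  refine Filter.eventually_lt_of_lt_liminf (hc.trans_le ?_)
  refine le_trans (lintegral_mono fun s ↦ ?_)
    (lintegral_liminf_le' fun t ↦ (hg.measurable.comp measurable_prodMk_right).aemeasurable)
  have : LowerSemicontinuousAt (fun t ↦ g (s, t)) t₀ := hg.comp (by fun_prop) t₀
  exact this.le_liminf

/-- The average of `v` over a segment in a direction of `Σ_N` is controlled by the directional
maximal function at every point of the segment, for `v` lower semicontinuous. -/
theorem lintegral_segment_le {N : ℕ} {e : ℝ × ℝ} (he : e ∈ SigmaN N) {v : ℝ × ℝ → ℝ≥0∞}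
    (hv : LowerSemicontinuous v) {a b : ℝ} {z : ℝ × ℝ} (hz : (frame e z).1 ∈ Ioo a b) :
    ∫⁻ s in Ioo a b, v (unframe e (s, (frame e z).2)) ≤
      ENNReal.ofReal (b - a) * basisMax volume (IsDirRect N) v z := by
  have hu := norm_sq_of_mem_SigmaN he
  have hab : 0 < b - a := by linarith [hz.1, hz.2]
  set t₀ := (frame e z).2 with ht₀
  set g : ℝ × ℝ → ℝ≥0∞ := fun q ↦ v (unframe e q)
  have hg : LowerSemicontinuous g := hv.comp (continuous_unframe e)
  refine le_of_forall_lt_imp_le_of_dense fun c hc ↦ ?_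
  have hlsc := lowerSemicontinuousAt_lintegral_section hg (volume.restrict (Ioo a b)) t₀ c hc
  obtain ⟨δ, hδ, hball⟩ := Metric.eventually_nhds_iff.1 hlsc
  set ε := min δ ((b - a) / 2) with hε
  have hε0 : 0 < ε := lt_min hδ (by positivity)
  have hεδ : ε ≤ δ := min_le_left _ _
  have hεb : ε ≤ (b - a) / 2 := min_le_right _ _
  set T : Set (ℝ × ℝ) := Ioo a b ×ˢ Ioo (t₀ - ε) (t₀ + ε) with hT
  have hR : IsDirRect N (frame e ⁻¹' T) := isDirRect_preimage he (by linarith) (by linarith)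
  have hzR : z ∈ frame e ⁻¹' T := by
    refine ⟨hz, ?_, ?_⟩ <;> simp only [← ht₀] <;> linarith
  have hvol : volume (frame e ⁻¹' T) = ENNReal.ofReal (b - a) * ENNReal.ofReal (2 * ε) := by
    rw [(measurePreserving_frame hu).measure_preimage
      (measurableSet_Ioo.prod measurableSet_Ioo).nullMeasurableSet, volume_Ioo_prod_Ioo]
    congr 2; ring
  have hε2 : ENNReal.ofReal (2 * ε) ≠ 0 := by simpa using hε0
  have hab0 : ENNReal.ofReal (b - a) ≠ 0 := by simpa using hab
  have hlow : c * ENNReal.ofReal (2 * ε) ≤ ∫⁻ y in frame e ⁻¹' T, v y := by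
    rw [setLIntegral_unframe hu, hT, Measure.volume_eq_prod, ← Measure.prod_restrict,
      lintegral_prod_symm _ (hg.measurable.aemeasurable)]
    calc c * ENNReal.ofReal (2 * ε) = ∫⁻ _ in Ioo (t₀ - ε) (t₀ + ε), c := by
          rw [setLIntegral_const, Real.volume_Ioo]; ring_nf
      _ ≤ _ := by
          refine setLIntegral_mono' measurableSet_Ioo fun t ht ↦ ?_
          refine (hball ?_).le
          rw [Real.dist_eq, abs_lt]
          constructor <;> linarith [ht.1, ht.2]
  have hup : ∫⁻ y in frame e ⁻¹' T, v y ≤ basisMax volume (IsDirRect N) v z *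
      (ENNReal.ofReal (b - a) * ENNReal.ofReal (2 * ε)) := by
    rw [← hvol, ← ENNReal.div_le_iff]
    · exact le_basisMax hR hzR
    · rw [hvol]; exact mul_ne_zero hab0 hε2
    · rw [hvol]; finiteness
  have := hlow.trans hup
  rw [← mul_assoc] at this
  rw [mul_comm]
  exact (ENNReal.mul_le_mul_iff_left hε2 ENNReal.ofReal_ne_top).1 this

end LineAverage

section Sections

theorem lintegral_section_le_basisMax {u : ℝ × ℝ} (hu : u.1 ^ 2 + u.2 ^ 2 = 1) {y : ℝ × ℝ}
    {α β l L : ℝ} (hl : 0 < l) (hlL : l ≤ L) (hs : |(frame u y).1 - α| < L / 2)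
    (ht : |(frame u y).2 - β| < l / 2) {m : ℝ → ℝ≥0∞} {F : ℝ × ℝ → ℝ≥0∞}
    (hF : Measurable F) (hmF : ∀ z : ℝ × ℝ, |z.1 - α| < 7 * L → m z.2 ≤ F z) :
    ∫⁻ t in Ioo (β - l / 2) (β + l / 2), m t ≤
      ENNReal.ofReal (16 * l) * basisMax volume IsCube2 (fun z ↦ F (frame u z)) y := by
  set s₀ := (frame u y).1
  set t₀ := (frame u y).2
  set J := Ioo (β - l / 2) (β + l / 2)
  have hl0 : ENNReal.ofReal l ≠ 0 := by simpa using hl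
  rw [abs_lt] at hs ht
  have hbox := setLIntegral_le_basisMax_frame hu (y := y) hl
    (T := Ioo (s₀ - l / 2) (s₀ + l / 2) ×ˢ J) (fun z hz ↦ by
      obtain ⟨⟨h1, h2⟩, h3, h4⟩ := hz
      simp only [abs_lt]
      refine ⟨⟨?_, ?_⟩, ?_, ?_⟩ <;> linarith) F
  have hlow : ENNReal.ofReal l * ∫⁻ t in J, m t ≤
      ∫⁻ z in Ioo (s₀ - l / 2) (s₀ + l / 2) ×ˢ J, F z := by
    rw [Measure.volume_eq_prod, ← Measure.prod_restrict, lintegral_prod_symm _ hF.aemeasurable]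
    refine (lintegral_const_mul_le _ _).trans (lintegral_mono fun t ↦ ?_)
    calc ENNReal.ofReal l * m t = ∫⁻ _ in Ioo (s₀ - l / 2) (s₀ + l / 2), m t := by
          rw [setLIntegral_const, Real.volume_Ioo, mul_comm]; congr 2; ring
      _ ≤ _ := by
          refine setLIntegral_mono' measurableSet_Ioo fun s hs' ↦ hmF (s, t) ?_
          rw [abs_lt]
          constructor <;> simp only <;> linarith [hs'.1, hs'.2]
  have := hlow.trans hbox
  rw [show 16 * l ^ 2 = l * (16 * l) by ring, ENNReal.ofReal_mul hl.le, mul_assoc] at this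
  exact (ENNReal.mul_le_mul_iff_right hl0 ENNReal.ofReal_ne_top).1 this

/-- The supremum, over the intervals containing the first coordinate, of the weighted averages of
`f` on horizontal segments. -/
def sectionMax {ι : Type*} (S : Finset ι) (a b : ι → ℝ) (f v : ℝ × ℝ → ℝ≥0∞) (z : ℝ × ℝ) : ℝ≥0∞ :=
  ⨆ i ∈ S, (Ioo (a i) (b i) ×ˢ univ).indicator (fun z : ℝ × ℝ ↦
    (∫⁻ s in Ioo (a i) (b i), f (s, z.2) * v (s, z.2)) /
      ∫⁻ s in Ioo (a i) (b i), v (s, z.2)) z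

theorem measurable_lintegral_section {g : ℝ × ℝ → ℝ≥0∞} (hg : Measurable g) (I : Set ℝ) :
    Measurable fun t ↦ ∫⁻ s in I, g (s, t) := hg.lintegral_prod_left'

theorem measurable_sectionMax {ι : Type*} (S : Finset ι) (a b : ι → ℝ) {f v : ℝ × ℝ → ℝ≥0∞}
    (hf : Measurable f) (hv : Measurable v) : Measurable (sectionMax S a b f v) := by
  refine Measurable.biSup _ S.countable_toSet fun i _ ↦ Measurable.indicator ?_
    (measurableSet_Ioo.prod MeasurableSet.univ)
  exact ((measurable_lintegral_section (hf.mul hv) _).comp measurable_snd).div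
    ((measurable_lintegral_section hv _).comp measurable_snd)

theorem le_sectionMax {ι : Type*} {S : Finset ι} {a b : ι → ℝ} {f v : ℝ × ℝ → ℝ≥0∞} {i : ι}
    (hi : i ∈ S) {z : ℝ × ℝ} (hz : z.1 ∈ Ioo (a i) (b i)) :
    (∫⁻ s in Ioo (a i) (b i), f (s, z.2) * v (s, z.2)) / ∫⁻ s in Ioo (a i) (b i), v (s, z.2) ≤
      sectionMax S a b f v z := by
  refine le_iSup₂_of_le i hi ?_
  rw [indicator_of_mem (by exact ⟨hz, mem_univ _⟩)]

/-- A one-dimensional maximal inequality, with a density, on all the horizontal lines. -/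
theorem lintegral_sectionMax_le {ι : Type*} (S : Finset ι) (a b : ι → ℝ) {f v : ℝ × ℝ → ℝ≥0∞}
    (hf : Measurable f) (hv : Measurable v) {q : ℝ} (hq : 2 ≤ q) :
    ∫⁻ z, sectionMax S a b f v z ^ q * v z ≤
      ENNReal.ofReal (4 * 2 ^ q) * ∫⁻ z, f z ^ q * v z := by
  have hF := measurable_sectionMax S a b hf hv
  have h1 : Measurable fun z ↦ sectionMax S a b f v z ^ q * v z := (hF.pow_const q).mul hv
  have h2 : Measurable fun z ↦ f z ^ q * v z := (hf.pow_const q).mul hv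
  rw [Measure.volume_eq_prod, lintegral_prod_symm _ h1.aemeasurable,
    lintegral_prod_symm _ h2.aemeasurable, ← lintegral_const_mul' _ _ ENNReal.ofReal_ne_top]
  refine lintegral_mono fun t ↦ ?_
  have hft : Measurable fun s ↦ f (s, t) := hf.comp measurable_prodMk_right
  have hvt : Measurable fun s ↦ v (s, t) := hv.comp measurable_prodMk_right
  set σ : Measure ℝ := volume.withDensity fun s ↦ v (s, t)
  set B : Set ℝ → Prop := fun R ↦ ∃ i ∈ S, R = Ioo (a i) (b i)
  have hB : ∀ R, B R → ∃ a b, R = Ioo a b := fun R ⟨i, _, h⟩ ↦ ⟨a i, b i, h⟩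
  have hBo : ∀ R, B R → IsOpen R := fun R ⟨i, _, h⟩ ↦ h ▸ isOpen_Ioo
  have hle : ∀ s, sectionMax S a b f v (s, t) ≤ basisMax σ B (fun s ↦ f (s, t)) s := by
    refine fun s ↦ iSup₂_le fun i hi ↦ ?_
    by_cases hs : (s, t) ∈ Ioo (a i) (b i) ×ˢ (univ : Set ℝ)
    · rw [indicator_of_mem hs]
      refine le_trans (le_of_eq ?_) (le_basisMax (m := σ) (B := B) ⟨i, hi, rfl⟩ hs.1)
      rw [setLIntegral_withDensity_eq_setLIntegral_mul _ hvt hft measurableSet_Ioo,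
        withDensity_apply _ measurableSet_Ioo]
      simp only [Pi.mul_apply, mul_comm]
    · rw [indicator_of_notMem hs]
      exact zero_le
  have hstrong := basisMax_Ioo_strong (σ := σ) hB hft (r := q) (by linarith)
  rw [lintegral_withDensity_eq_lintegral_mul _ hvt (hft.pow_const q),
    lintegral_withDensity_eq_lintegral_mul _ hvt ((measurable_basisMax hBo _).pow_const q)]
    at hstrong
  calc ∫⁻ s, sectionMax S a b f v (s, t) ^ q * v (s, t)
      ≤ ∫⁻ s, ((fun s ↦ v (s, t)) * fun s ↦ basisMax σ B (fun s ↦ f (s, t)) s ^ q) s := by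
        refine lintegral_mono fun s ↦ ?_
        rw [Pi.mul_apply, mul_comm]
        gcongr
        exact hle s
    _ ≤ _ := hstrong
    _ ≤ ENNReal.ofReal (4 * 2 ^ q) * ∫⁻ s, f (s, t) ^ q * v (s, t) := by
        simp only [Pi.mul_apply, mul_comm (v _)]
        gcongr ?_ * _
        rw [show (2 : ℝ≥0∞) = ENNReal.ofReal 2 by simp, ← ENNReal.ofReal_mul (by norm_num),
          ← mul_assoc]
        gcongr
        have : q / (q - 1) ≤ 2 := by
          rw [div_le_iff₀ (by linarith)]; linarith
        linarith

end Sections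

section Duality

/-- A sum of indicators of boxes, weighted by the inverse masses of the horizontal sections. -/
def boxSum {ι : Type*} (S : Finset ι) (v : ℝ × ℝ → ℝ≥0∞) (I J : ι → Set ℝ) (κ : ι → ℝ≥0∞)
    (z : ℝ × ℝ) : ℝ≥0∞ :=
  ∑ i ∈ S, κ i * (I i ×ˢ J i).indicator (fun z ↦ (∫⁻ s in I i, v (s, z.2))⁻¹) z

theorem measurable_boxSum {ι : Type*} (S : Finset ι) {v : ℝ × ℝ → ℝ≥0∞} (hv : Measurable v)
    {I J : ι → Set ℝ} (hI : ∀ i, MeasurableSet (I i)) (hJ : ∀ i, MeasurableSet (J i))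
    (κ : ι → ℝ≥0∞) : Measurable (boxSum S v I J κ) :=
  Finset.measurable_sum _ fun i _ ↦ (Measurable.indicator
    ((measurable_lintegral_section hv _).comp measurable_snd).inv
      ((hI i).prod (hJ i))).const_mul _

theorem lintegral_boxSum_mul {ι : Type*} (S : Finset ι) {v : ℝ × ℝ → ℝ≥0∞} (hv : Measurable v)
    {I J : ι → Set ℝ} (hI : ∀ i, MeasurableSet (I i)) (hJ : ∀ i, MeasurableSet (J i))
    (κ : ι → ℝ≥0∞) {f : ℝ × ℝ → ℝ≥0∞} (hf : Measurable f) :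
    ∫⁻ z, boxSum S v I J κ z * (f z * v z) = ∑ i ∈ S, κ i * ∫⁻ t in J i,
      (∫⁻ s in I i, f (s, t) * v (s, t)) / ∫⁻ s in I i, v (s, t) := by
  have hfv : Measurable fun z ↦ f z * v z := hf.mul hv
  have hV : ∀ i, Measurable fun z : ℝ × ℝ ↦ (∫⁻ s in I i, v (s, z.2))⁻¹ := fun i ↦
    ((measurable_lintegral_section hv (I i)).comp measurable_snd).inv
  have hVfv : ∀ i, Measurable fun z : ℝ × ℝ ↦
      (∫⁻ s in I i, v (s, z.2))⁻¹ * (f z * v z) := fun i ↦ (hV i).mul hfv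
  have hterm : ∀ i, Measurable fun z ↦ (I i ×ˢ J i).indicator
      (fun z ↦ (∫⁻ s in I i, v (s, z.2))⁻¹ * (f z * v z)) z := fun i ↦
    ((hV i).mul hfv).indicator ((hI i).prod (hJ i))
  have h1 : ∀ z, boxSum S v I J κ z * (f z * v z) = ∑ i ∈ S, κ i * (I i ×ˢ J i).indicator
      (fun z ↦ (∫⁻ s in I i, v (s, z.2))⁻¹ * (f z * v z)) z := by
    intro z
    rw [boxSum, Finset.sum_mul]
    refine Finset.sum_congr rfl fun i _ ↦ ?_
    rw [mul_assoc]
    congr 1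
    by_cases hz : z ∈ I i ×ˢ J i
    · simp only [indicator_of_mem hz]
    · simp only [indicator_of_notMem hz, zero_mul]
  simp_rw [h1]
  rw [lintegral_finsetSum _ fun i _ ↦ (hterm i).const_mul _]
  refine Finset.sum_congr rfl fun i _ ↦ ?_
  rw [lintegral_const_mul _ (hterm i), lintegral_indicator ((hI i).prod (hJ i)),
    Measure.volume_eq_prod, ← Measure.prod_restrict,
    lintegral_prod_symm _ (hVfv i).aemeasurable]
  congr 1
  refine lintegral_congr fun t ↦ ?_
  have hft : Measurable fun s ↦ f (s, t) * v (s, t) := hfv.comp measurable_prodMk_right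
  dsimp only
  rw [lintegral_const_mul _ hft, div_eq_mul_inv, mul_comm]

variable {ι : Type*} {S : Finset ι} {u : ℝ × ℝ} {w : ℝ × ℝ → ℝ≥0∞} {α β l L : ι → ℝ}
  {E : ι → Set (ℝ × ℝ)}

theorem lintegral_boxSum_mul_le (hu : u.1 ^ 2 + u.2 ^ 2 = 1) (hw : Measurable w)
    (hl : ∀ i ∈ S, 0 < l i) (hlL : ∀ i ∈ S, l i ≤ L i) (hEm : ∀ i ∈ S, MeasurableSet (E i))
    (hEd : (S : Set ι).PairwiseDisjoint E)
    (hE : ∀ i ∈ S, ∀ z ∈ E i, |(frame u z).1 - α i| < L i / 2 ∧ |(frame u z).2 - β i| < l i / 2)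
    {v f : ℝ × ℝ → ℝ≥0∞} (hv : Measurable v) (hf : Measurable f) :
    ∫⁻ z, boxSum S v (fun i ↦ Ioo (α i - 7 * L i) (α i + 7 * L i))
        (fun i ↦ Ioo (β i - l i / 2) (β i + l i / 2))
        (fun i ↦ (∫⁻ z in E i, w z) / ENNReal.ofReal (l i)) z * (f z * v z) ≤
      16 * ∫⁻ z in ⋃ i ∈ S, E i, basisMax volume IsCube2
        (fun z ↦ sectionMax S (fun i ↦ α i - 7 * L i) (fun i ↦ α i + 7 * L i) f v (frame u z)) z
          * w z := by
  rw [lintegral_boxSum_mul S hv (fun _ ↦ measurableSet_Ioo) (fun _ ↦ measurableSet_Ioo) _ hf,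
    lintegral_biUnion_finset hEd hEm, Finset.mul_sum]
  refine Finset.sum_le_sum fun i hi ↦ ?_
  set X := ∫⁻ t in Ioo (β i - l i / 2) (β i + l i / 2),
    (∫⁻ s in Ioo (α i - 7 * L i) (α i + 7 * L i), f (s, t) * v (s, t)) /
      ∫⁻ s in Ioo (α i - 7 * L i) (α i + 7 * L i), v (s, t)
  set G := basisMax volume IsCube2
    (fun z ↦ sectionMax S (fun i ↦ α i - 7 * L i) (fun i ↦ α i + 7 * L i) f v (frame u z))
  have hl0 : ENNReal.ofReal (l i) ≠ 0 := by simpa using hl i hi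
  have hX : ∀ y ∈ E i, X / ENNReal.ofReal (l i) ≤ 16 * G y := by
    intro y hy
    obtain ⟨h1, h2⟩ := hE i hi y hy
    have := lintegral_section_le_basisMax hu (hl i hi) (hlL i hi) h1 h2
      (m := fun t ↦ (∫⁻ s in Ioo (α i - 7 * L i) (α i + 7 * L i), f (s, t) * v (s, t)) /
        ∫⁻ s in Ioo (α i - 7 * L i) (α i + 7 * L i), v (s, t))
      (measurable_sectionMax S (fun i ↦ α i - 7 * L i) (fun i ↦ α i + 7 * L i) hf hv)
      (fun z hz ↦ le_sectionMax (a := fun i ↦ α i - 7 * L i) (b := fun i ↦ α i + 7 * L i) hi (by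
        rw [abs_lt] at hz
        constructor <;> linarith [hz.1, hz.2]))
    refine ENNReal.div_le_of_le_mul (this.trans_eq ?_)
    rw [ENNReal.ofReal_mul (by norm_num)]
    simp only [ENNReal.ofReal_ofNat]
    ring
  calc (∫⁻ z in E i, w z) / ENNReal.ofReal (l i) * X
      = ∫⁻ z in E i, X / ENNReal.ofReal (l i) * w z := by
        rw [lintegral_const_mul _ hw, div_eq_mul_inv, div_eq_mul_inv]; ring
    _ ≤ ∫⁻ z in E i, 16 * (G z * w z) := by
        refine setLIntegral_mono' (hEm i hi) fun y hy ↦ ?_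
        rw [← mul_assoc]
        gcongr
        exact hX y hy
    _ = _ := lintegral_const_mul' _ _ (by norm_num)

/-- The dual estimate for rectangles in one direction. -/
theorem lintegral_boxSum_rpow_le (hu : u.1 ^ 2 + u.2 ^ 2 = 1) (hw : Measurable w)
    (hl : ∀ i ∈ S, 0 < l i) (hlL : ∀ i ∈ S, l i ≤ L i) (hEm : ∀ i ∈ S, MeasurableSet (E i))
    (hEd : (S : Set ι).PairwiseDisjoint E)
    (hE : ∀ i ∈ S, ∀ z ∈ E i, |(frame u z).1 - α i| < L i / 2 ∧ |(frame u z).2 - β i| < l i / 2)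
    {q r : ℝ} (hqr : r.HolderConjugate q) (hq : 2 ≤ q) {v h : ℝ × ℝ → ℝ≥0∞}
    (hvdef : v = fun z ↦ basisMax volume IsCube2 w (unframe u z))
    (hh : h = boxSum S v (fun i ↦ Ioo (α i - 7 * L i) (α i + 7 * L i))
        (fun i ↦ Ioo (β i - l i / 2) (β i + l i / 2))
        (fun i ↦ (∫⁻ z in E i, w z) / ENNReal.ofReal (l i)))
    (hfin : ∫⁻ z, h z ^ r * v z ≠ ⊤) :
    (∫⁻ z, h z ^ r * v z) ^ (1 / r) ≤
      12800 * (∑ i ∈ S, ∫⁻ z in E i, w z) ^ (1 / r) := by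
  have hB : ∀ R : Set (ℝ × ℝ), IsCube2 R → IsOpen R := fun R hR ↦ hR.isOpen
  have hv : Measurable v := by
    rw [hvdef]; exact (measurable_basisMax hB w).comp (continuous_unframe u).measurable
  have hhm : Measurable h := by
    rw [hh]
    exact measurable_boxSum S hv (fun _ ↦ measurableSet_Ioo) (fun _ ↦ measurableSet_Ioo) _
  have hr0 : 0 < r := hqr.pos
  have hq0 : 0 < q := hqr.symm.pos
  have hr1 : 1 < r := hqr.lt
  set X := ∫⁻ z, h z ^ r * v z with hX
  set f : ℝ × ℝ → ℝ≥0∞ := fun z ↦ h z ^ (r - 1) with hf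
  have hfm : Measurable f := hhm.pow_const _
  set F := sectionMax S (fun i ↦ α i - 7 * L i) (fun i ↦ α i + 7 * L i) f v with hF
  have hFm : Measurable F := measurable_sectionMax _ _ _ hfm hv
  set G := basisMax volume IsCube2 fun z ↦ F (frame u z) with hG
  have hGm : Measurable G := measurable_basisMax hB _
  set U := ⋃ i ∈ S, E i with hU
  have hUm : MeasurableSet U := Finset.measurableSet_biUnion _ hEm
  have hXeq : X = ∫⁻ z, h z * (f z * v z) := by
    refine lintegral_congr fun z ↦ ?_
    rw [← mul_assoc]
    congr 1
    have : h z * f z = h z ^ (1 : ℝ) * h z ^ (r - 1) := by rw [ENNReal.rpow_one]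
    rw [this, ← ENNReal.rpow_add_of_nonneg _ _ zero_le_one (by linarith)]
    congr 1; ring
  have hfq : ∫⁻ z, f z ^ q * v z = X := by
    refine lintegral_congr fun z ↦ ?_
    rw [hf]
    simp only
    rw [← ENNReal.rpow_mul]
    congr 2
    have := hqr.mul_eq_add
    linarith
  have hpair : X ≤ 16 * ∫⁻ z in U, G z * w z := by
    rw [hXeq, hh]
    exact lintegral_boxSum_mul_le hu hw hl hlL hEm hEd hE hv hfm
  have hGq : ∫⁻ z, G z ^ q * w z ≤ ENNReal.ofReal (200 * 4 ^ q) * X := by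
    have h1 := feffermanStein_strong hw (h := fun z ↦ F (frame u z))
      (hFm.comp (continuous_frame u).measurable) (r := q) (by linarith)
    have h2 := lintegral_sectionMax_le S (fun i ↦ α i - 7 * L i) (fun i ↦ α i + 7 * L i) hfm hv hq
    have h3 : ∫⁻ z, F (frame u z) ^ q * basisMax volume IsCube2 w z = ∫⁻ z, F z ^ q * v z := by
      rw [← lintegral_frame hu (fun z ↦ F z ^ q * v z), hvdef]
      simp only [unframe_frame hu]
    rw [h3] at h1
    rw [hfq] at h2
    calc ∫⁻ z, G z ^ q * w z
        ≤ 25 * ENNReal.ofReal (q / (q - 1) * 2 ^ q) * (ENNReal.ofReal (4 * 2 ^ q) * X) :=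
          h1.trans (mul_le_mul_right h2 _)
      _ ≤ _ := by
          rw [← mul_assoc]
          gcongr ?_ * _
          rw [show (25 : ℝ≥0∞) = ENNReal.ofReal 25 by simp, ← ENNReal.ofReal_mul (by norm_num),
            ← ENNReal.ofReal_mul (by
              have : 0 < q / (q - 1) := div_pos hq0 (by linarith)
              positivity)]
          refine ENNReal.ofReal_le_ofReal ?_
          have : q / (q - 1) ≤ 2 := by
            rw [div_le_iff₀ (by linarith)]; linarith
          have h4 : (4 : ℝ) ^ q = 2 ^ q * 2 ^ q := by
            rw [← Real.mul_rpow (by norm_num) (by norm_num)]; norm_num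
          have hp : (0 : ℝ) < 2 ^ q := by positivity
          rw [h4]
          nlinarith [mul_pos hp hp]
  set μ : Measure (ℝ × ℝ) := volume.withDensity w
  have hμU : μ U = ∑ i ∈ S, ∫⁻ z in E i, w z := by
    rw [withDensity_apply _ hUm, lintegral_biUnion_finset hEd hEm]
  have hholder : ∫⁻ z in U, G z * w z ≤ μ U ^ (1 / r) * (∫⁻ z, G z ^ q * w z) ^ (1 / q) := by
    have := ENNReal.lintegral_mul_le_Lp_mul_Lq μ hqr (f := U.indicator 1) (g := G)
      (measurable_one.indicator hUm).aemeasurable hGm.aemeasurable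
    have e1 : ∫⁻ z, (U.indicator 1 z : ℝ≥0∞) ^ r ∂μ = μ U := by
      rw [← lintegral_indicator_one hUm]
      refine lintegral_congr fun z ↦ ?_
      by_cases hz : z ∈ U <;> simp [hz, hr0]
    have e2 : ∫⁻ z, (U.indicator (1 : ℝ × ℝ → ℝ≥0∞) * G) z ∂μ = ∫⁻ z in U, G z * w z := by
      rw [lintegral_withDensity_eq_lintegral_mul _ hw ((measurable_one.indicator hUm).mul hGm),
        ← lintegral_indicator hUm]
      refine lintegral_congr fun z ↦ ?_
      by_cases hz : z ∈ U <;> simp [hz, mul_comm]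
    have e3 : ∫⁻ z, G z ^ q ∂μ = ∫⁻ z, G z ^ q * w z := by
      rw [lintegral_withDensity_eq_lintegral_mul _ hw (hGm.pow_const q)]
      simp only [Pi.mul_apply, mul_comm]
    rwa [e1, e2, e3] at this
  rw [← hμU]
  have hmain : X ≤ 12800 * μ U ^ (1 / r) * X ^ (1 / q) := by
    calc X ≤ 16 * (μ U ^ (1 / r) * (ENNReal.ofReal (200 * 4 ^ q) * X) ^ (1 / q)) := by
          refine hpair.trans ?_
          gcongr
          refine hholder.trans ?_
          gcongr
      _ = 16 * ENNReal.ofReal (200 * 4 ^ q) ^ (1 / q) * μ U ^ (1 / r) * X ^ (1 / q) := by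
          rw [ENNReal.mul_rpow_of_nonneg _ _ (by positivity)]; ring
      _ ≤ _ := by
          gcongr ?_ * _ * _
          rw [ENNReal.ofReal_rpow_of_nonneg (by positivity) (by positivity),
            Real.mul_rpow (by norm_num) (by positivity), ← Real.rpow_mul (by norm_num),
            mul_one_div_cancel hq0.ne', Real.rpow_one]
          have h200 : (200 : ℝ) ^ (1 / q) ≤ 200 := by
            conv_rhs => rw [← Real.rpow_one 200]
            refine Real.rpow_le_rpow_of_exponent_le (by norm_num) ?_
            rw [div_le_one hq0]; linarith
          calc (16 : ℝ≥0∞) * ENNReal.ofReal (200 ^ (1 / q) * 4)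
              ≤ 16 * ENNReal.ofReal (200 * 4) := by gcongr
            _ = 12800 := by
                rw [show (16 : ℝ≥0∞) = ENNReal.ofReal 16 by simp,
                  ← ENNReal.ofReal_mul (by norm_num)]
                norm_num
  rcases eq_or_ne X 0 with h0 | h0
  · rw [h0, ENNReal.zero_rpow_of_pos (by positivity)]; exact zero_le
  · have hXq0 : X ^ (1 / q) ≠ 0 := by simp [ENNReal.rpow_eq_zero_iff, h0, hfin]
    have hXqT : X ^ (1 / q) ≠ ⊤ := ENNReal.rpow_ne_top_of_nonneg (by positivity) hfin
    have hsplit : X = X ^ (1 / r) * X ^ (1 / q) := by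
      rw [← ENNReal.rpow_add _ _ h0 hfin, one_div, one_div, hqr.inv_add_inv_eq_one,
        ENNReal.rpow_one]
    refine (ENNReal.mul_le_mul_iff_left hXq0 hXqT).1 ?_
    rw [← hsplit]
    exact hmain

end Duality

section Slices

theorem dirRect_eq_preimage_dirRect {u : ℝ × ℝ} (hu : u.1 ^ 2 + u.2 ^ 2 = 1) (e c : ℝ × ℝ)
    (l L : ℝ) : dirRect e c l L = frame u ⁻¹' dirRect (frame u e) (frame u c) l L := by
  ext z
  simp only [dirRect, frame, mem_ofPred_eq, mem_preimage]
  have h1 : (z.1 * u.1 + z.2 * u.2 - (c.1 * u.1 + c.2 * u.2)) * (e.1 * u.1 + e.2 * u.2) +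
      (z.2 * u.1 - z.1 * u.2 - (c.2 * u.1 - c.1 * u.2)) * (e.2 * u.1 - e.1 * u.2) =
      (z.1 - c.1) * e.1 + (z.2 - c.2) * e.2 := by
    linear_combination ((z.1 - c.1) * e.1 + (z.2 - c.2) * e.2) * hu
  have h2 : (z.2 * u.1 - z.1 * u.2 - (c.2 * u.1 - c.1 * u.2)) * (e.1 * u.1 + e.2 * u.2) -
      (z.1 * u.1 + z.2 * u.2 - (c.1 * u.1 + c.2 * u.2)) * (e.2 * u.1 - e.1 * u.2) =
      (z.2 - c.2) * e.1 - (z.1 - c.1) * e.2 := by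
    linear_combination ((z.2 - c.2) * e.1 - (z.1 - c.1) * e.2) * hu
  rw [h1, h2]

theorem norm_sq_frame {u e : ℝ × ℝ} (hu : u.1 ^ 2 + u.2 ^ 2 = 1) (he : e.1 ^ 2 + e.2 ^ 2 = 1) :
    (frame u e).1 ^ 2 + (frame u e).2 ^ 2 = 1 := by
  simp only [frame]
  linear_combination (e.1 ^ 2 + e.2 ^ 2) * hu + he

theorem volume_abs_affine_lt {a k d : ℝ} (ha : a ≠ 0) :
    volume {s : ℝ | |s * a + k| < d / 2} ≤ ENNReal.ofReal (d / |a|) := by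
  have ha' : 0 < |a| := abs_pos.2 ha
  have : {s : ℝ | |s * a + k| < d / 2} ⊆ Ioo (-k / a - d / (2 * |a|)) (-k / a + d / (2 * |a|)) := by
    intro s hs
    have h1 : |s - -k / a| < d / (2 * |a|) := by
      rw [lt_div_iff₀ (by positivity)]
      have : |s - -k / a| * |a| = |s * a + k| := by
        rw [← abs_mul]; congr 1; field_simp; ring
      have h2 : |s * a + k| < d / 2 := hs
      linarith
    rw [abs_lt] at h1
    constructor <;> linarith [h1.1, h1.2]
  refine (measure_mono this).trans_eq ?_
  rw [Real.volume_Ioo]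
  congr 1
  field_simp
  ring

/-- The semi-length of the projection of a rectangle with direction `e`. -/
def projLen (e : ℝ × ℝ) (l L : ℝ) : ℝ := |e.2| * L + |e.1| * l

theorem projLen_pos {e : ℝ × ℝ} (he : e.1 ^ 2 + e.2 ^ 2 = 1) {l L : ℝ} (hl : 0 < l) (hL : 0 < L) :
    0 < projLen e l L := by
  rcases eq_or_ne e.1 0 with h | h
  · have : e.2 ≠ 0 := by rintro h2; simp [h, h2] at he
    have : 0 < |e.2| := abs_pos.2 this
    unfold projLen; positivity
  · have : 0 < |e.1| := abs_pos.2 h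
    unfold projLen; positivity

theorem volume_slice_dirRect_le {e c : ℝ × ℝ} (he : e.1 ^ 2 + e.2 ^ 2 = 1) {l L : ℝ} (hl : 0 < l)
    (hL : 0 < L) (t : ℝ) :
    volume {s : ℝ | (s, t) ∈ dirRect e c l L} ≤ ENNReal.ofReal (2 * l * L / projLen e l L) := by
  have hp := projLen_pos he hl hL
  rcases le_total (|e.1| * l) (|e.2| * L) with h | h
  · have h2 : 0 < |e.2| := by
      by_contra! h0
      have h0' : |e.2| = 0 := le_antisymm h0 (abs_nonneg _)
      have : projLen e l L ≤ 2 * (|e.2| * L) := by unfold projLen; linarith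
      rw [h0'] at this; linarith
    refine (measure_mono ?_).trans ((volume_abs_affine_lt (a := -e.2) (d := l)
      (k := (t - c.2) * e.1 + c.1 * e.2) (neg_ne_zero.2 (abs_pos.1 h2))).trans ?_)
    · rintro s ⟨_, hs⟩
      simp only [mem_ofPred_eq] at hs ⊢
      convert hs using 2
      ring
    · rw [abs_neg]
      refine ENNReal.ofReal_le_ofReal ?_
      rw [div_le_div_iff₀ h2 hp]
      unfold projLen
      nlinarith
  · have h2 : 0 < |e.1| := by
      by_contra! h0
      have h0' : |e.1| = 0 := le_antisymm h0 (abs_nonneg _)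
      have : projLen e l L ≤ 2 * (|e.1| * l) := by unfold projLen; linarith
      rw [h0'] at this; linarith
    refine (measure_mono ?_).trans ((volume_abs_affine_lt (a := e.1) (d := L)
      (k := (t - c.2) * e.2 - c.1 * e.1) (abs_pos.1 h2)).trans ?_)
    · rintro s ⟨hs, _⟩
      simp only [mem_ofPred_eq] at hs ⊢
      convert hs using 2
      ring
    · refine ENNReal.ofReal_le_ofReal ?_
      rw [div_le_div_iff₀ h2 hp]
      unfold projLen
      nlinarith

theorem abs_sub_le_of_mem_dirRect {e c : ℝ × ℝ} (he : e.1 ^ 2 + e.2 ^ 2 = 1) {l L : ℝ}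
    {x z : ℝ × ℝ} (hx : x ∈ dirRect e c l L) (hz : z ∈ dirRect e c l L) :
    |z.1 - x.1| ≤ L + l ∧ |z.2 - x.2| ≤ projLen e l L := by
  obtain ⟨hx1, hx2⟩ := hx
  obtain ⟨hz1, hz2⟩ := hz
  set p := (z.1 - x.1) * e.1 + (z.2 - x.2) * e.2 with hp
  set q := (z.2 - x.2) * e.1 - (z.1 - x.1) * e.2 with hq
  rw [abs_lt] at hx1 hx2 hz1 hz2
  have hpL : |p| ≤ L := abs_le.2 ⟨by linarith, by linarith⟩
  have hql : |q| ≤ l := abs_le.2 ⟨by linarith, by linarith⟩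
  have h1 : |e.1| ≤ 1 := abs_le.2 ⟨by nlinarith, by nlinarith⟩
  have h2 : |e.2| ≤ 1 := abs_le.2 ⟨by nlinarith, by nlinarith⟩
  have e1 : z.1 - x.1 = p * e.1 - q * e.2 := by
    rw [hp, hq]; linear_combination -(z.1 - x.1) * he
  have e2 : z.2 - x.2 = e.2 * p + e.1 * q := by
    rw [hp, hq]; linear_combination -(z.2 - x.2) * he
  constructor
  · rw [e1]
    refine (abs_sub _ _).trans (add_le_add ?_ ?_) <;> rw [abs_mul]
    · exact (mul_le_of_le_one_right (abs_nonneg _) h1).trans hpL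
    · exact (mul_le_of_le_one_right (abs_nonneg _) h2).trans hql
  · rw [e2]
    refine (abs_add_le _ _).trans (add_le_add ?_ ?_) <;> rw [abs_mul]
    · exact mul_le_mul_of_nonneg_left hpL (abs_nonneg _)
    · exact mul_le_mul_of_nonneg_left hql (abs_nonneg _)

/-- The integral over a rectangle of a function of the second coordinate, localized to a long
strip, is controlled by the integral over a square. -/
theorem setLIntegral_dirRect_le {e c : ℝ × ℝ} (he : e.1 ^ 2 + e.2 ^ 2 = 1) {l L L' : ℝ}
    (hl : 0 < l) (hlL : l ≤ L) (hLL : L ≤ L') {x : ℝ × ℝ} (hx : x ∈ dirRect e c l L) {α : ℝ}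
    {J : Set ℝ} (hJ : MeasurableSet J) {κ : ℝ → ℝ≥0∞} (hκ : Measurable κ) {ρ : ℝ}
    (hρ : ρ = 2 * projLen e l L) :
    ∫⁻ z in dirRect e c l L,
        (Ioo (α - L' / 2) (α + L' / 2) ×ˢ J).indicator (fun z ↦ κ z.2) z ≤
      ENNReal.ofReal (2 * l * L / ρ ^ 2) *
        ∫⁻ z in Ioo (x.1 - ρ) (x.1 + ρ) ×ˢ Ioo (x.2 - ρ) (x.2 + ρ),
          (Ioo (α - 7 * L') (α + 7 * L') ×ˢ J).indicator (fun z ↦ κ z.2) z := by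
  have hL : 0 < L := hl.trans_le hlL
  have hp := projLen_pos he hl hL
  have hρ0 : 0 < ρ := by linarith
  have h1 : |e.1| ≤ 1 := abs_le.2 ⟨by nlinarith, by nlinarith⟩
  have h2 : |e.2| ≤ 1 := abs_le.2 ⟨by nlinarith, by nlinarith⟩
  have hρL : ρ ≤ 4 * L' := by
    rw [hρ]; unfold projLen; nlinarith
  set R := dirRect e c l L with hR
  have hRm : MeasurableSet R := (isOpen_dirRect e c l L).measurableSet
  set φ := J.indicator κ with hφ
  have hφm : Measurable φ := hκ.indicator hJ
  have hφ2 : Measurable fun z : ℝ × ℝ ↦ φ z.2 := hφm.comp measurable_snd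
  by_cases hne : ∃ z ∈ R, z.1 ∈ Ioo (α - L' / 2) (α + L' / 2)
  swap
  · refine le_of_eq_of_le ?_ zero_le
    rw [← lintegral_zero (μ := volume.restrict R)]
    refine setLIntegral_congr_fun hRm fun z hz ↦ ?_
    exact indicator_of_notMem (fun h ↦ hne ⟨z, hz, h.1⟩) _
  obtain ⟨z₀, hz₀, hz₀I⟩ := hne
  have hx1 := (abs_sub_le_of_mem_dirRect he hx hz₀).1
  rw [abs_le] at hx1
  have hslice : ∀ t, ∫⁻ s, R.indicator (fun z ↦ φ z.2) (s, t) ≤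
      (Ioo (x.2 - ρ) (x.2 + ρ)).indicator
        (fun t ↦ ENNReal.ofReal (2 * l * L / projLen e l L) * φ t) t := by
    intro t
    by_cases ht : t ∈ Ioo (x.2 - ρ) (x.2 + ρ)
    · rw [indicator_of_mem ht]
      have hm : MeasurableSet {s : ℝ | (s, t) ∈ R} := measurable_prodMk_right hRm
      calc ∫⁻ s, R.indicator (fun z ↦ φ z.2) (s, t)
          = ∫⁻ s, {s : ℝ | (s, t) ∈ R}.indicator (fun _ ↦ φ t) s := lintegral_congr fun s ↦ rfl
        _ = φ t * volume {s : ℝ | (s, t) ∈ R} := by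
            rw [lintegral_indicator hm, setLIntegral_const]
        _ ≤ _ := by
            rw [mul_comm]
            gcongr
            exact volume_slice_dirRect_le he hl hL t
    · rw [indicator_of_notMem ht]
      refine (lintegral_eq_zero_of_ae_eq_zero (Filter.Eventually.of_forall fun s ↦ ?_)).le
      refine indicator_of_notMem (fun hs ↦ ht ?_) _
      have := (abs_sub_le_of_mem_dirRect he hx hs).2
      rw [abs_le] at this
      constructor <;> linarith [this.1, this.2]
  calc ∫⁻ z in R, (Ioo (α - L' / 2) (α + L' / 2) ×ˢ J).indicator (fun z ↦ κ z.2) z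
      ≤ ∫⁻ z in R, φ z.2 := by
        refine lintegral_mono fun z ↦ ?_
        by_cases hz : z ∈ Ioo (α - L' / 2) (α + L' / 2) ×ˢ J
        · rw [indicator_of_mem hz, hφ, indicator_of_mem hz.2]
        · rw [indicator_of_notMem hz]; exact zero_le
    _ = ∫⁻ t, ∫⁻ s, R.indicator (fun z ↦ φ z.2) (s, t) := by
        rw [← lintegral_indicator hRm, Measure.volume_eq_prod,
          lintegral_prod_symm _ (hφ2.indicator hRm).aemeasurable]
    _ ≤ ENNReal.ofReal (2 * l * L / projLen e l L) * ∫⁻ t in Ioo (x.2 - ρ) (x.2 + ρ), φ t := by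
        rw [← lintegral_const_mul _ hφm, ← lintegral_indicator measurableSet_Ioo]
        exact lintegral_mono hslice
    _ = ENNReal.ofReal (2 * l * L / ρ ^ 2) *
        ∫⁻ z in Ioo (x.1 - ρ) (x.1 + ρ) ×ˢ Ioo (x.2 - ρ) (x.2 + ρ), φ z.2 := by
        rw [Measure.volume_eq_prod, ← Measure.prod_restrict,
          lintegral_prod_symm _ hφ2.aemeasurable]
        simp only [lintegral_const, Measure.restrict_apply_univ, Real.volume_Ioo]
        rw [lintegral_mul_const _ hφm, mul_comm (∫⁻ t in _, φ t), ← mul_assoc,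
          ← ENNReal.ofReal_mul (by positivity)]
        congr 2
        rw [hρ]
        field_simp
        ring
    _ = _ := by
        congr 1
        refine setLIntegral_congr_fun (measurableSet_Ioo.prod measurableSet_Ioo) fun z hz ↦ ?_
        obtain ⟨⟨ha, hb⟩, -⟩ := hz
        have hzI : z.1 ∈ Ioo (α - 7 * L') (α + 7 * L') := by
          constructor <;> linarith [hz₀I.1, hz₀I.2, hx1.1, hx1.2]
        by_cases hzJ : z.2 ∈ J
        · have hm : z ∈ Ioo (α - 7 * L') (α + 7 * L') ×ˢ J := ⟨hzI, hzJ⟩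
          rw [indicator_of_mem hm, hφ, indicator_of_mem hzJ]
        · have hm : z ∉ Ioo (α - 7 * L') (α + 7 * L') ×ˢ J := fun h ↦ hzJ h.2
          rw [indicator_of_notMem hm, hφ, indicator_of_notMem hzJ]

end Slices

section OneDirection

/-- The function dual to a family of rectangles in the direction `e`, in the frame of `e`. -/
def stripSum {ι : Type*} (S : Finset ι) (v : ℝ × ℝ → ℝ≥0∞) (e : ℝ × ℝ) (c : ι → ℝ × ℝ)
    (l L : ι → ℝ) (a : ι → ℝ≥0∞) : ℝ × ℝ → ℝ≥0∞ :=
  boxSum S (fun z ↦ v (unframe e z))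
    (fun i ↦ Ioo ((frame e (c i)).1 - 7 * L i) ((frame e (c i)).1 + 7 * L i))
    (fun i ↦ Ioo ((frame e (c i)).2 - l i / 2) ((frame e (c i)).2 + l i / 2))
    (fun i ↦ a i / ENNReal.ofReal (l i))

theorem measurable_stripSum {ι : Type*} (S : Finset ι) {v : ℝ × ℝ → ℝ≥0∞} (hv : Measurable v)
    (e : ℝ × ℝ) (c : ι → ℝ × ℝ) (l L : ι → ℝ) (a : ι → ℝ≥0∞) :
    Measurable (stripSum S v e c l L a) :=
  measurable_boxSum S (hv.comp (continuous_unframe e).measurable) (fun _ ↦ measurableSet_Ioo)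
    (fun _ ↦ measurableSet_Ioo) _

theorem inv_basisMax_le {N : ℕ} {e : ℝ × ℝ} (he : e ∈ SigmaN N) {v : ℝ × ℝ → ℝ≥0∞}
    (hv : LowerSemicontinuous v) {a b : ℝ} {z : ℝ × ℝ} (hz : (frame e z).1 ∈ Ioo a b) :
    (basisMax volume (IsDirRect N) v z)⁻¹ ≤
      ENNReal.ofReal (b - a) * (∫⁻ s in Ioo a b, v (unframe e (s, (frame e z).2)))⁻¹ := by
  have hab : 0 < b - a := by linarith [hz.1, hz.2]
  have h0 : ENNReal.ofReal (b - a) ≠ 0 := by simpa using hab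
  have h := ENNReal.inv_le_inv.2 (lintegral_segment_le he hv hz)
  rw [ENNReal.mul_inv (Or.inl h0) (Or.inl ENNReal.ofReal_ne_top)] at h
  calc (basisMax volume (IsDirRect N) v z)⁻¹
      = ENNReal.ofReal (b - a) *
          ((ENNReal.ofReal (b - a))⁻¹ * (basisMax volume (IsDirRect N) v z)⁻¹) := by
        rw [← mul_assoc, ENNReal.mul_inv_cancel h0 ENNReal.ofReal_ne_top, one_mul]
    _ ≤ _ := mul_le_mul_right h _

/-- The overlap of a rectangle with a rectangle of larger long side, in the metric `1 / W`. -/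
theorem setLIntegral_inter_inv_le {N : ℕ} {e e' : ℝ × ℝ} (he : e ∈ SigmaN N)
    (he' : e'.1 ^ 2 + e'.2 ^ 2 = 1) {v : ℝ × ℝ → ℝ≥0∞} (hv : LowerSemicontinuous v)
    {c c' x : ℝ × ℝ} {l L l' L' : ℝ} (hl' : 0 < l') (hlL' : l' ≤ L')
    (hLL : L' ≤ L) (hx : x ∈ dirRect e' c' l' L') {ρ : ℝ}
    (hρ : ρ = 2 * projLen (frame e e') l' L') :
    ∫⁻ z in dirRect e c l L ∩ dirRect e' c' l' L', (basisMax volume (IsDirRect N) v z)⁻¹ ≤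
      ENNReal.ofReal (14 * L) * (ENNReal.ofReal (2 * l' * L' / ρ ^ 2) *
        ∫⁻ z in Ioo ((frame e x).1 - ρ) ((frame e x).1 + ρ) ×ˢ
            Ioo ((frame e x).2 - ρ) ((frame e x).2 + ρ),
          (Ioo ((frame e c).1 - 7 * L) ((frame e c).1 + 7 * L) ×ˢ
            Ioo ((frame e c).2 - l / 2) ((frame e c).2 + l / 2)).indicator
              (fun z ↦ (∫⁻ s in Ioo ((frame e c).1 - 7 * L) ((frame e c).1 + 7 * L),
                v (unframe e (s, z.2)))⁻¹) z) := by
  have hu := norm_sq_of_mem_SigmaN he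
  have hL0 : 0 < L := by linarith
  set α := (frame e c).1
  set β := (frame e c).2
  set κ : ℝ → ℝ≥0∞ := fun t ↦ (∫⁻ s in Ioo (α - 7 * L) (α + 7 * L), v (unframe e (s, t)))⁻¹
    with hκ
  have hκm : Measurable κ := (measurable_lintegral_section
    (hv.measurable.comp (continuous_unframe e).measurable) _).inv
  set J := Ioo (β - l / 2) (β + l / 2)
  set G : ℝ × ℝ → ℝ≥0∞ := (Ioo (α - L / 2) (α + L / 2) ×ˢ J).indicator fun z ↦ κ z.2 with hG
  have hx' : frame e x ∈ dirRect (frame e e') (frame e c') l' L' := by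
    rw [dirRect_eq_preimage_dirRect hu] at hx
    exact hx
  have hB := setLIntegral_dirRect_le (norm_sq_frame hu he') hl' hlL' hLL hx' (α := α)
    (measurableSet_Ioo : MeasurableSet J) hκm hρ
  have hm1 : MeasurableSet (dirRect e c l L) := (isOpen_dirRect e c l L).measurableSet
  have hm2 : MeasurableSet (dirRect e' c' l' L') := (isOpen_dirRect e' c' l' L').measurableSet
  calc ∫⁻ z in dirRect e c l L ∩ dirRect e' c' l' L', (basisMax volume (IsDirRect N) v z)⁻¹
      ≤ ∫⁻ z in dirRect e c l L ∩ dirRect e' c' l' L', ENNReal.ofReal (14 * L) * G (frame e z) := by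
        refine setLIntegral_mono' (hm1.inter hm2) fun z hz ↦ ?_
        have hz1 := hz.1
        rw [dirRect_eq_preimage] at hz1
        have hz2 : frame e z ∈ Ioo (α - L / 2) (α + L / 2) ×ˢ J := hz1
        have hzG : G (frame e z) = κ (frame e z).2 := by rw [hG, indicator_of_mem hz2]
        rw [hzG]
        have := inv_basisMax_le he hv (a := α - 7 * L) (b := α + 7 * L) (z := z)
          ⟨by linarith [hz1.1.1], by linarith [hz1.1.2]⟩
        rwa [show α + 7 * L - (α - 7 * L) = 14 * L by ring] at this
    _ ≤ ∫⁻ z in dirRect e' c' l' L', ENNReal.ofReal (14 * L) * G (frame e z) :=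
        lintegral_mono_set inter_subset_right
    _ = ENNReal.ofReal (14 * L) * ∫⁻ z in dirRect (frame e e') (frame e c') l' L', G z := by
        rw [lintegral_const_mul' _ _ ENNReal.ofReal_ne_top, dirRect_eq_preimage_dirRect hu,
          setLIntegral_frame hu]
    _ ≤ _ := mul_le_mul_right hB _

theorem sum_setLIntegral_inter_inv_le {ι : Type*} {N : ℕ} {e e' : ℝ × ℝ} (he : e ∈ SigmaN N)
    (he' : e'.1 ^ 2 + e'.2 ^ 2 = 1) {v : ℝ × ℝ → ℝ≥0∞} (hv : LowerSemicontinuous v)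
    {S S' : Finset ι} (hS : S' ⊆ S) {c : ι → ℝ × ℝ} {l L : ι → ℝ} (hl : ∀ i ∈ S, 0 < l i)
    (a : ι → ℝ≥0∞) {c' x : ℝ × ℝ} {l' L' : ℝ} (hl' : 0 < l') (hlL' : l' ≤ L')
    (hLL : ∀ i ∈ S', L' ≤ L i) (hx : x ∈ dirRect e' c' l' L') :
    ∑ i ∈ S', a i / volume (dirRect e (c i) (l i) (L i)) *
        ∫⁻ z in dirRect e (c i) (l i) (L i) ∩ dirRect e' c' l' L',
          (basisMax volume (IsDirRect N) v z)⁻¹ ≤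
      volume (dirRect e' c' l' L') *
        (448 * basisMax volume IsCube2 (fun z ↦ stripSum S v e c l L a (frame e z)) x) := by
  have hu := norm_sq_of_mem_SigmaN he
  have hL' : 0 < L' := hl'.trans_le hlL'
  set ρ := 2 * projLen (frame e e') l' L' with hρ
  have hρ0 : 0 < ρ := by
    have := projLen_pos (norm_sq_frame hu he') hl' hL'
    linarith
  set Q := Ioo ((frame e x).1 - ρ) ((frame e x).1 + ρ) ×ˢ
            Ioo ((frame e x).2 - ρ) ((frame e x).2 + ρ) with hQ
  have hvm : Measurable fun z ↦ v (unframe e z) :=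
    hv.measurable.comp (continuous_unframe e).measurable
  set H : ι → ℝ × ℝ → ℝ≥0∞ := fun i ↦
    (Ioo ((frame e (c i)).1 - 7 * L i) ((frame e (c i)).1 + 7 * L i) ×ˢ
      Ioo ((frame e (c i)).2 - l i / 2) ((frame e (c i)).2 + l i / 2)).indicator
        (fun z ↦ (∫⁻ s in Ioo ((frame e (c i)).1 - 7 * L i) ((frame e (c i)).1 + 7 * L i),
          v (unframe e (s, z.2)))⁻¹) with hH
  have hHm : ∀ i, Measurable (H i) := fun i ↦
    (((measurable_lintegral_section hvm _).comp measurable_snd).inv).indicator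
      (measurableSet_Ioo.prod measurableSet_Ioo)
  have hterm : ∀ i ∈ S', a i / volume (dirRect e (c i) (l i) (L i)) *
        ∫⁻ z in dirRect e (c i) (l i) (L i) ∩ dirRect e' c' l' L',
          (basisMax volume (IsDirRect N) v z)⁻¹ ≤
      ENNReal.ofReal (28 * l' * L' / ρ ^ 2) *
        ((a i / ENNReal.ofReal (l i)) * ∫⁻ z in Q, H i z) := by
    intro i hi
    have hLi : 0 < L i := hL'.trans_le (hLL i hi)
    have hli := hl i (hS hi)
    have hL0 : ENNReal.ofReal (L i) ≠ 0 := by simpa using hLi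
    have hl0 : ENNReal.ofReal (l i) ≠ 0 := by simpa using hli
    have h : ∫⁻ z in dirRect e (c i) (l i) (L i) ∩ dirRect e' c' l' L',
        (basisMax volume (IsDirRect N) v z)⁻¹ ≤ ENNReal.ofReal (14 * L i) *
          (ENNReal.ofReal (2 * l' * L' / ρ ^ 2) * ∫⁻ z in Q, H i z) :=
      setLIntegral_inter_inv_le he he' hv hl' hlL' (hLL i hi) hx hρ
    refine (mul_le_mul_right h _).trans_eq ?_
    rw [volume_dirRect hu, ENNReal.ofReal_mul (p := 14) (by norm_num), div_eq_mul_inv (a i),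
      ENNReal.mul_inv (Or.inl hL0) (Or.inl ENNReal.ofReal_ne_top), div_eq_mul_inv (a i),
      show 28 * l' * L' / ρ ^ 2 = 14 * (2 * l' * L' / ρ ^ 2) by ring,
      ENNReal.ofReal_mul (p := 14) (by norm_num)]
    calc _ = ((ENNReal.ofReal (L i))⁻¹ * ENNReal.ofReal (L i)) *
          (ENNReal.ofReal 14 * ENNReal.ofReal (2 * l' * L' / ρ ^ 2) *
            (a i * (ENNReal.ofReal (l i))⁻¹ * ∫⁻ z in Q, H i z)) := by ring
      _ = _ := by rw [ENNReal.inv_mul_cancel hL0 ENNReal.ofReal_ne_top, one_mul]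
  calc _ ≤ ∑ i ∈ S', ENNReal.ofReal (28 * l' * L' / ρ ^ 2) *
        ((a i / ENNReal.ofReal (l i)) * ∫⁻ z in Q, H i z) := Finset.sum_le_sum hterm
    _ ≤ ∑ i ∈ S, ENNReal.ofReal (28 * l' * L' / ρ ^ 2) *
        ((a i / ENNReal.ofReal (l i)) * ∫⁻ z in Q, H i z) :=
        Finset.sum_le_sum_of_subset hS
    _ = ENNReal.ofReal (28 * l' * L' / ρ ^ 2) * ∫⁻ z in Q, stripSum S v e c l L a z := by
        rw [← Finset.mul_sum]
        congr 1
        unfold stripSum boxSum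
        rw [lintegral_finsetSum _ fun i _ ↦ (hHm i).const_mul _]
        refine Finset.sum_congr rfl fun i _ ↦ ?_
        rw [lintegral_const_mul _ (hHm i)]
    _ ≤ ENNReal.ofReal (28 * l' * L' / ρ ^ 2) * (ENNReal.ofReal (16 * ρ ^ 2) *
        basisMax volume IsCube2 (fun z ↦ stripSum S v e c l L a (frame e z)) x) := by
        refine mul_le_mul_right (setLIntegral_le_basisMax_frame hu hρ0 (fun z hz ↦ ?_) _) _
        obtain ⟨⟨h1, h2⟩, h3, h4⟩ := hz
        constructor <;> rw [abs_lt] <;> constructor <;> linarith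
    _ = _ := by
        rw [volume_dirRect he', ← mul_assoc, ← mul_assoc, ← ENNReal.ofReal_mul (by positivity),
          ← ENNReal.ofReal_mul hL'.le, show (448 : ℝ≥0∞) = ENNReal.ofReal 448 by simp,
          ← ENNReal.ofReal_mul (by positivity)]
        congr 2
        field_simp
        norm_num

end OneDirection

section DirectionSum

theorem basisMax_isCube2_ne_zero {w : ℝ × ℝ → ℝ≥0∞} (hw0 : ∫⁻ z, w z ≠ 0)
    (x : ℝ × ℝ) : basisMax volume IsCube2 w x ≠ 0 := by
  intro h
  set Q : ℕ → Set (ℝ × ℝ) := fun n ↦ Ioo (x.1 - (n + 1)) (x.1 - (n + 1) + 2 * (n + 1)) ×ˢ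
    Ioo (x.2 - (n + 1)) (x.2 - (n + 1) + 2 * (n + 1)) with hQ
  have hn0 : ∀ n : ℕ, (0 : ℝ) < n + 1 := fun n ↦ by positivity
  have hQc : ∀ n, IsCube2 (Q n) := fun n ↦ ⟨_, _, _, by have := hn0 n; linarith, rfl⟩
  have hxQ : ∀ n, x ∈ Q n := fun n ↦ by
    have := hn0 n
    exact ⟨⟨by linarith, by linarith⟩, by linarith, by linarith⟩
  have hzero : ∀ n, ∫⁻ z in Q n, w z = 0 := by
    intro n
    have h1 := le_basisMax (m := volume) (g := w) (hQc n) (hxQ n)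
    rw [h, nonpos_iff_eq_zero, ENNReal.div_eq_zero_iff] at h1
    refine h1.resolve_right ?_
    rw [hQ, volume_Ioo_prod_Ioo]
    exact ENNReal.mul_ne_top ENNReal.ofReal_ne_top ENNReal.ofReal_ne_top
  have hU : (⋃ n, Q n) = univ := by
    refine eq_univ_of_forall fun z ↦ ?_
    obtain ⟨n, hn⟩ := exists_nat_gt (max |z.1 - x.1| |z.2 - x.2|)
    have h1 := abs_lt.1 ((le_max_left _ _).trans_lt hn)
    have h2 := abs_lt.1 ((le_max_right _ _).trans_lt hn)
    exact mem_iUnion.2 ⟨n, ⟨by linarith [h1.1], by linarith [h1.2]⟩,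
      by linarith [h2.1], by linarith [h2.2]⟩
  refine hw0 (nonpos_iff_eq_zero.1 ?_)
  rw [← setLIntegral_univ, ← hU]
  refine (lintegral_iUnion_le _ _).trans ?_
  simp [hzero]

theorem lintegral_stripSum_rpow_ne_top {ι : Type*} (S : Finset ι) {v : ℝ × ℝ → ℝ≥0∞}
    (hv : LowerSemicontinuous v) (hv0 : ∀ x, v x ≠ 0) {k : ℝ≥0∞} (hk : k ≠ ⊤)
    (hvk : ∀ x, v x ≤ k) (e : ℝ × ℝ) (c : ι → ℝ × ℝ) {l L : ι → ℝ}
    (hl : ∀ i ∈ S, 0 < l i) (hL : ∀ i ∈ S, 0 < L i) {a : ι → ℝ≥0∞} (ha : ∀ i ∈ S, a i ≠ ⊤)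
    {r : ℝ} (hr : 0 < r) :
    ∫⁻ z, stripSum S v e c l L a z ^ r * v (unframe e z) ≠ ⊤ := by
  set I : ι → Set ℝ := fun i ↦ Ioo ((frame e (c i)).1 - 7 * L i) ((frame e (c i)).1 + 7 * L i)
    with hI
  set J : ι → Set ℝ := fun i ↦ Ioo ((frame e (c i)).2 - l i / 2) ((frame e (c i)).2 + l i / 2)
    with hJ
  have hlow : ∀ i, ∃ ε : ℝ≥0∞, ε ≠ 0 ∧ ∀ z ∈ I i ×ˢ J i, ε ≤ v (unframe e z) := by
    intro i
    set K := Icc ((frame e (c i)).1 - 7 * L i) ((frame e (c i)).1 + 7 * L i) ×ˢ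
      Icc ((frame e (c i)).2 - l i / 2) ((frame e (c i)).2 + l i / 2) with hK
    have hsub : I i ×ˢ J i ⊆ K := prod_mono Ioo_subset_Icc_self Ioo_subset_Icc_self
    rcases K.eq_empty_or_nonempty with h | h
    · exact ⟨1, one_ne_zero, fun z hz ↦ by have := hsub hz; simp [h] at this⟩
    · obtain ⟨y, _, hy⟩ := ((hv.comp (continuous_unframe e)).lowerSemicontinuousOn
        K).exists_isMinOn h (isCompact_Icc.prod isCompact_Icc)
      exact ⟨v (unframe e y), hv0 _, fun z hz ↦ hy (hsub hz)⟩
  choose ε hε0 hε using hlow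
  set U := ⋃ i ∈ S, I i ×ˢ J i with hU
  set C := ∑ i ∈ S, a i / ENNReal.ofReal (l i) * (ε i * ENNReal.ofReal (14 * L i))⁻¹ with hC
  have hCtop : C ≠ ⊤ := by
    refine ENNReal.sum_ne_top.2 fun i hi ↦ ENNReal.mul_ne_top
      (ENNReal.div_ne_top (ha i hi) (by simpa using hl i hi)) (ENNReal.inv_ne_top.2 ?_)
    exact mul_ne_zero (hε0 i) (by simpa using hL i hi)
  have hUm : MeasurableSet U := Finset.measurableSet_biUnion _ fun i _ ↦
    measurableSet_Ioo.prod measurableSet_Ioo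
  have hUv : volume U ≠ ⊤ := by
    refine ((measure_biUnion_finset_le S _).trans_lt (ENNReal.sum_lt_top.2 fun i _ ↦ ?_)).ne
    rw [hI, hJ, volume_Ioo_prod_Ioo]
    exact ENNReal.mul_lt_top ENNReal.ofReal_lt_top ENNReal.ofReal_lt_top
  have hle : ∀ z, stripSum S v e c l L a z ≤ C := by
    intro z
    refine Finset.sum_le_sum fun i _ ↦ mul_le_mul_right ?_ _
    by_cases hz : z ∈ I i ×ˢ J i
    · refine (indicator_of_mem hz _).trans_le (ENNReal.inv_le_inv.2 ?_)
      calc ε i * ENNReal.ofReal (14 * L i) = ∫⁻ _ in I i, ε i := by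
            rw [setLIntegral_const, hI, Real.volume_Ioo]; ring_nf
        _ ≤ _ := setLIntegral_mono' measurableSet_Ioo fun s hs ↦ hε i (s, z.2) ⟨hs, hz.2⟩
    · exact (indicator_of_notMem hz _).trans_le zero_le
  have hout : ∀ z ∉ U, stripSum S v e c l L a z = 0 := by
    intro z hz
    refine Finset.sum_eq_zero fun i hi ↦ ?_
    have : z ∉ I i ×ˢ J i := fun h ↦ hz (mem_biUnion hi h)
    exact mul_eq_zero_of_right _ (indicator_of_notMem this _)
  refine ne_top_of_le_ne_top (ENNReal.mul_ne_top (ENNReal.mul_ne_top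
    (ENNReal.rpow_ne_top_of_nonneg hr.le hCtop) hk) hUv) (b := C ^ r * k * volume U) ?_
  calc _ ≤ ∫⁻ z, U.indicator (fun _ ↦ C ^ r * k) z := by
        refine lintegral_mono fun z ↦ ?_
        by_cases hz : z ∈ U
        · rw [indicator_of_mem hz]
          exact mul_le_mul' (ENNReal.rpow_le_rpow (hle z) hr.le) (hvk _)
        · rw [hout z hz, ENNReal.zero_rpow_of_pos hr, zero_mul]; exact zero_le
    _ = _ := by rw [lintegral_indicator hUm, setLIntegral_const]

variable {ι : Type*} {N : ℕ} {T : Finset ι} {w : ℝ × ℝ → ℝ≥0∞} {e c : ι → ℝ × ℝ}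
  {l L : ι → ℝ} {E : ι → Set (ℝ × ℝ)}

theorem setLIntegral_basisMax_mul_le {w g : ℝ × ℝ → ℝ≥0∞} (hw : Measurable w) (hg : Measurable g)
    {U : Set (ℝ × ℝ)} (hU : MeasurableSet U) {q r : ℝ} (hqr : r.HolderConjugate q) (hq : 2 ≤ q) :
    ∫⁻ z in U, basisMax volume IsCube2 g z * w z ≤
      ENNReal.ofReal (100 * q) * (∫⁻ z in U, w z) ^ (1 / q) *
        (∫⁻ z, g z ^ r * basisMax volume IsCube2 w z) ^ (1 / r) := by
  have hB : ∀ R : Set (ℝ × ℝ), IsCube2 R → IsOpen R := fun R hR ↦ hR.isOpen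
  have hr0 : 0 < r := hqr.pos
  have hr1 : 1 < r := hqr.lt
  have hq0 : 0 < q := hqr.symm.pos
  have hr2 : r ≤ 2 := by
    have := hqr.mul_eq_add
    nlinarith
  set G := basisMax volume IsCube2 g
  have hGm : Measurable G := measurable_basisMax hB _
  set μ : Measure (ℝ × ℝ) := volume.withDensity w
  have hholder : ∫⁻ z in U, G z * w z ≤ (∫⁻ z in U, w z) ^ (1 / q) *
      (∫⁻ z, G z ^ r * w z) ^ (1 / r) := by
    have := ENNReal.lintegral_mul_le_Lp_mul_Lq μ hqr.symm (f := U.indicator 1) (g := G)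
      (measurable_one.indicator hU).aemeasurable hGm.aemeasurable
    have e1 : ∫⁻ z, (U.indicator 1 z : ℝ≥0∞) ^ q ∂μ = ∫⁻ z in U, w z := by
      rw [← withDensity_apply _ hU, ← lintegral_indicator_one hU]
      refine lintegral_congr fun z ↦ ?_
      by_cases hz : z ∈ U <;> simp [hz, hq0]
    have e2 : ∫⁻ z, (U.indicator (1 : ℝ × ℝ → ℝ≥0∞) * G) z ∂μ = ∫⁻ z in U, G z * w z := by
      rw [lintegral_withDensity_eq_lintegral_mul _ hw ((measurable_one.indicator hU).mul hGm),
        ← lintegral_indicator hU]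
      refine lintegral_congr fun z ↦ ?_
      by_cases hz : z ∈ U <;> simp [hz, mul_comm]
    have e3 : ∫⁻ z, G z ^ r ∂μ = ∫⁻ z, G z ^ r * w z := by
      rw [lintegral_withDensity_eq_lintegral_mul _ hw (hGm.pow_const r)]
      simp only [Pi.mul_apply, mul_comm]
    rwa [e1, e2, e3] at this
  set Y := ∫⁻ z, g z ^ r * basisMax volume IsCube2 w z
  have hconst : (25 * ENNReal.ofReal (r / (r - 1) * 2 ^ r)) ^ (1 / r) ≤
      ENNReal.ofReal (100 * q) := by
    have hrq : r / (r - 1) = q := by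
      have := hqr.mul_eq_add
      rw [div_eq_iff (by linarith)]
      linarith
    rw [hrq, show (25 : ℝ≥0∞) = ENNReal.ofReal 25 by simp, ← ENNReal.ofReal_mul (by norm_num),
      ENNReal.ofReal_rpow_of_nonneg (by positivity) (by positivity)]
    refine ENNReal.ofReal_le_ofReal ?_
    have h4 : (2 : ℝ) ^ r ≤ 4 := by
      calc (2 : ℝ) ^ r ≤ 2 ^ (2 : ℝ) := Real.rpow_le_rpow_of_exponent_le (by norm_num) hr2
        _ = 4 := by norm_num
    calc (25 * (q * 2 ^ r)) ^ (1 / r) ≤ (100 * q) ^ (1 / r) := by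
          refine Real.rpow_le_rpow (by positivity) ?_ (by positivity)
          nlinarith
      _ ≤ (100 * q) ^ (1 : ℝ) := by
          refine Real.rpow_le_rpow_of_exponent_le (by linarith) ?_
          rw [div_le_one hr0]; exact hr1.le
      _ = 100 * q := Real.rpow_one _
  calc _ ≤ (∫⁻ z in U, w z) ^ (1 / q) *
      (25 * ENNReal.ofReal (r / (r - 1) * 2 ^ r) * Y) ^ (1 / r) := by
        refine hholder.trans ?_
        gcongr
        exact feffermanStein_strong hw hg hr1
    _ ≤ (∫⁻ z in U, w z) ^ (1 / q) * (ENNReal.ofReal (100 * q) * Y ^ (1 / r)) := by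
        rw [ENNReal.mul_rpow_of_nonneg _ _ (by positivity)]
        gcongr
    _ = _ := by ring

open Classical in
theorem direction_sum_le (he : ∀ i ∈ T, e i ∈ SigmaN N) (hl : ∀ i ∈ T, 0 < l i)
    (hlL : ∀ i ∈ T, l i ≤ L i) (hEm : ∀ i ∈ T, MeasurableSet (E i))
    (hEd : (T : Set ι).PairwiseDisjoint E)
    (hE : ∀ i ∈ T, E i ⊆ dirRect (e i) (c i) (l i) (L i)) (hw : Measurable w)
    (hw0 : ∫⁻ z, w z ≠ 0) {k : ℝ≥0∞} (hk : k ≠ ⊤) (hwk : ∀ x, w x ≤ k)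
    {d : ℝ × ℝ} (hd : d ∈ SigmaN N) {q r : ℝ} (hqr : r.HolderConjugate q) (hq : 2 ≤ q)
    (hfin : ∀ i ∈ T, ∫⁻ z in E i, w z ≠ ⊤) :
    ∑ j ∈ T, (∫⁻ z in E j, w z) / volume (dirRect (e j) (c j) (l j) (L j)) *
        ∑ i ∈ T with e i = d ∧ L j ≤ L i,
          (∫⁻ z in E i, w z) / volume (dirRect (e i) (c i) (l i) (L i)) *
            ∫⁻ z in dirRect (e i) (c i) (l i) (L i) ∩ dirRect (e j) (c j) (l j) (L j),
              (basisMax volume (IsDirRect N) (basisMax volume IsCube2 w) z)⁻¹ ≤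
      ENNReal.ofReal (573440000 * q) * ((∑ i ∈ T, ∫⁻ z in E i, w z) ^ (1 / q) *
        (∑ i ∈ T with e i = d, ∫⁻ z in E i, w z) ^ (1 / r)) := by
  have hu := norm_sq_of_mem_SigmaN hd
  have hB : ∀ R : Set (ℝ × ℝ), IsCube2 R → IsOpen R := fun R hR ↦ hR.isOpen
  set v := basisMax volume IsCube2 w with hv
  have hvl : LowerSemicontinuous v := lowerSemicontinuous_basisMax hB w
  have hL : ∀ i ∈ T, 0 < L i := fun i hi ↦ (hl i hi).trans_le (hlL i hi)
  set a : ι → ℝ≥0∞ := fun i ↦ ∫⁻ z in E i, w z with ha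
  set S := T.filter fun i ↦ e i = d with hS
  have hST : S ⊆ T := Finset.filter_subset _ _
  set h := stripSum S v d c l L a with hh
  have hhm : Measurable h := measurable_stripSum S hvl.measurable _ _ _ _ _
  set G := basisMax volume IsCube2 fun z ↦ h (frame d z) with hG
  have hterm : ∀ j ∈ T, (a j) / volume (dirRect (e j) (c j) (l j) (L j)) *
        ∑ i ∈ T with e i = d ∧ L j ≤ L i,
          (a i) / volume (dirRect (e i) (c i) (l i) (L i)) *
            ∫⁻ z in dirRect (e i) (c i) (l i) (L i) ∩ dirRect (e j) (c j) (l j) (L j),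
              (basisMax volume (IsDirRect N) v z)⁻¹ ≤ ∫⁻ z in E j, 448 * (G z * w z) := by
    intro j hj
    have hej := norm_sq_of_mem_SigmaN (he j hj)
    set X := ∑ i ∈ T with e i = d ∧ L j ≤ L i,
          (a i) / volume (dirRect (e i) (c i) (l i) (L i)) *
            ∫⁻ z in dirRect (e i) (c i) (l i) (L i) ∩ dirRect (e j) (c j) (l j) (L j),
              (basisMax volume (IsDirRect N) v z)⁻¹ with hX
    set R := volume (dirRect (e j) (c j) (l j) (L j)) with hR
    have hRv : R = ENNReal.ofReal (L j) * ENNReal.ofReal (l j) := volume_dirRect hej _ _ _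
    have hXle : ∀ x ∈ E j, X / R ≤ 448 * G x := by
      intro x hx
      refine ENNReal.div_le_of_le_mul' ?_
      have := sum_setLIntegral_inter_inv_le (S := S)
        (S' := T.filter fun i ↦ e i = d ∧ L j ≤ L i) hd hej hvl
        (fun i hi ↦ by
          rw [Finset.mem_filter] at hi ⊢
          exact ⟨hi.1, hi.2.1⟩) (c := c) (L := L) (fun i hi ↦ hl i (hST hi)) a
        (hl j hj) (hlL j hj) (fun i hi ↦ (Finset.mem_filter.1 hi).2.2) (hE j hj hx)
      refine le_of_eq_of_le (Finset.sum_congr rfl fun i hi ↦ ?_) this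
      rw [(Finset.mem_filter.1 hi).2.1]
    calc a j / R * X = ∫⁻ z in E j, X / R * w z := by
          rw [lintegral_const_mul _ hw, div_eq_mul_inv, div_eq_mul_inv]; ring
      _ ≤ _ := by
          refine setLIntegral_mono' (hEm j hj) fun x hx ↦ ?_
          rw [← mul_assoc]
          gcongr
          exact hXle x hx
  have hUm : MeasurableSet (⋃ i ∈ T, E i) := Finset.measurableSet_biUnion _ hEm
  have hvk : ∀ x, v x ≤ k := basisMax_le_of_le hwk
  have hfinh := lintegral_stripSum_rpow_ne_top S hvl (basisMax_isCube2_ne_zero hw0) hk hvk d c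
    (fun i hi ↦ hl i (hST hi)) (fun i hi ↦ hL i (hST hi)) (a := a)
    (fun i hi ↦ hfin i (hST hi)) hqr.pos
  have hP := lintegral_boxSum_rpow_le (S := S) (α := fun i ↦ (frame d (c i)).1)
    (β := fun i ↦ (frame d (c i)).2) (l := l) (L := L) (E := E) hu hw
    (fun i hi ↦ hl i (hST hi)) (fun i hi ↦ hlL i (hST hi)) (fun i hi ↦ hEm i (hST hi))
    (hEd.subset (by exact_mod_cast hST)) (fun i hi z hz ↦ by
      have := hE i (hST hi) hz
      rw [(Finset.mem_filter.1 hi).2, dirRect_eq_preimage] at this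
      obtain ⟨⟨h1, h2⟩, h3, h4⟩ := this
      constructor <;> rw [abs_lt] <;> constructor <;> linarith) hqr hq rfl rfl hfinh
  have hFS := setLIntegral_basisMax_mul_le hw (g := fun z ↦ h (frame d z))
    (hhm.comp (continuous_frame d).measurable) hUm hqr hq
  have hchange : ∫⁻ z, h (frame d z) ^ r * v z = ∫⁻ z, h z ^ r * v (unframe d z) := by
    rw [← lintegral_frame hu (fun z ↦ h z ^ r * v (unframe d z))]
    simp only [unframe_frame hu]
  calc _ ≤ ∑ j ∈ T, ∫⁻ z in E j, 448 * (G z * w z) := Finset.sum_le_sum hterm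
    _ = 448 * ∫⁻ z in ⋃ i ∈ T, E i, G z * w z := by
        rw [← lintegral_biUnion_finset hEd hEm, lintegral_const_mul' _ _ (by norm_num)]
    _ ≤ 448 * (ENNReal.ofReal (100 * q) * (∑ i ∈ T, a i) ^ (1 / q) *
          (12800 * (∑ i ∈ S, a i) ^ (1 / r))) := by
        refine mul_le_mul_right (hFS.trans ?_) _
        rw [lintegral_biUnion_finset hEd hEm, hchange]
        exact mul_le_mul_right hP _
    _ = _ := by
        rw [show (573440000 * q) = 448 * (100 * q) * 12800 by ring,
          ENNReal.ofReal_mul (p := 448 * (100 * q)) (by have := hqr.symm.pos; positivity),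
          ENNReal.ofReal_mul (p := 448) (by norm_num)]
        simp only [ENNReal.ofReal_ofNat]
        ring

end DirectionSum

section Overlap

theorem ENNReal.rpow_mul_rpow_le_add {q r : ℝ} (hqr : r.HolderConjugate q) (x y : ℝ≥0∞) :
    x ^ (1 / q) * y ^ (1 / r) ≤ x + y := by
  have hr0 : 0 < r := hqr.pos
  have hq0 : 0 < q := hqr.symm.pos
  calc x ^ (1 / q) * y ^ (1 / r) ≤ max x y ^ (1 / q) * max x y ^ (1 / r) := by
        gcongr
        · exact le_max_left _ _
        · exact le_max_right _ _
    _ = max x y := by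
        rw [← ENNReal.rpow_add_of_nonneg _ _ (by positivity) (by positivity), one_div, one_div,
          hqr.symm.inv_add_inv_eq_one, ENNReal.rpow_one]
    _ ≤ x + y := max_le (le_add_right le_rfl) (le_add_left le_rfl)

theorem card_image_SigmaN_le [DecidableEq (ℝ × ℝ)] {ι : Type*} {N : ℕ} {T : Finset ι}
    {e : ι → ℝ × ℝ} (he : ∀ i ∈ T, e i ∈ SigmaN N) : (T.image e).card ≤ N := by
  have : T.image e ⊆ (Finset.range N).image
      fun j : ℕ ↦ (Real.cos (2 * π * j / N), Real.sin (2 * π * j / N)) := by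
    intro d hd
    obtain ⟨i, hi, rfl⟩ := Finset.mem_image.1 hd
    obtain ⟨j, hj, h⟩ := he i hi
    exact Finset.mem_image.2 ⟨j, Finset.mem_range.2 hj, h.symm⟩
  exact (Finset.card_le_card this).trans (Finset.card_image_le.trans_eq (Finset.card_range N))

theorem two_le_log {N : ℕ} (hN : 10 < N) : 2 ≤ Real.log N := by
  rw [Real.le_log_iff_exp_le (by positivity)]
  have h1 : Real.exp 2 = Real.exp 1 * Real.exp 1 := by rw [← Real.exp_add]; norm_num
  have h2 : (10 : ℝ) < N := by exact_mod_cast hN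
  have h3 := Real.exp_one_lt_d9
  have h4 := Real.exp_pos 1
  nlinarith

variable {ι : Type*} {N : ℕ} {T : Finset ι} {w : ℝ × ℝ → ℝ≥0∞} {e c : ι → ℝ × ℝ}
  {l L : ι → ℝ} {E : ι → Set (ℝ × ℝ)}

open Classical in
theorem sum_rpow_log_le (hN : 10 < N) (he : ∀ i ∈ T, e i ∈ SigmaN N) (a : ι → ℝ≥0∞) {r : ℝ}
    (hqr : r.HolderConjugate (Real.log N)) :
    ∑ d ∈ T.image e, (∑ i ∈ T, a i) ^ (1 / Real.log N) *
      (∑ i ∈ T with e i = d, a i) ^ (1 / r) ≤ 6 * ∑ i ∈ T, a i := by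
  set A := ∑ i ∈ T, a i with hA
  have hq0 : 0 < Real.log N := hqr.symm.pos
  have hN0 : (N : ℝ≥0∞) ≠ 0 := by simp; omega
  have hNe : (N : ℝ≥0∞) ^ (1 / Real.log N) ≤ 3 := by
    have hNr : (0 : ℝ) < N := by exact_mod_cast (by omega : 0 < N)
    rw [← ENNReal.ofReal_natCast, ENNReal.ofReal_rpow_of_nonneg hNr.le (by positivity),
      show (3 : ℝ≥0∞) = ENNReal.ofReal 3 by simp]
    refine ENNReal.ofReal_le_ofReal ?_
    rw [Real.rpow_def_of_pos hNr, mul_one_div_cancel hq0.ne']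
    linarith [Real.exp_one_lt_d9]
  have hsplit : A = N * (A / N) := (ENNReal.mul_div_cancel hN0 (ENNReal.natCast_ne_top N)).symm
  calc _ ≤ ∑ d ∈ T.image e, 3 * (A / N + ∑ i ∈ T with e i = d, a i) := by
        refine Finset.sum_le_sum fun d _ ↦ ?_
        conv_lhs => rw [hsplit]
        rw [ENNReal.mul_rpow_of_nonneg _ _ (by positivity), mul_assoc]
        exact mul_le_mul' hNe (ENNReal.rpow_mul_rpow_le_add hqr _ _)
    _ = 3 * ((T.image e).card * (A / N) + A) := by
        rw [← Finset.mul_sum, Finset.sum_add_distrib, Finset.sum_const, nsmul_eq_mul,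
          Finset.sum_fiberwise_of_maps_to fun i hi ↦ Finset.mem_image_of_mem e hi]
    _ ≤ 3 * (N * (A / N) + A) := by
        gcongr
        exact_mod_cast card_image_SigmaN_le he
    _ = 6 * A := by rw [← hsplit]; ring

open Classical in
/-- The linearized adjoint of the maximal operator over the directions of `Σ_N`, tested in the
metric `1 / W`. -/
theorem lintegral_sum_indicator_sq_le (hN : 10 < N) (he : ∀ i ∈ T, e i ∈ SigmaN N)
    (hl : ∀ i ∈ T, 0 < l i)
    (hlL : ∀ i ∈ T, l i ≤ L i) (hEm : ∀ i ∈ T, MeasurableSet (E i))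
    (hEd : (T : Set ι).PairwiseDisjoint E)
    (hE : ∀ i ∈ T, E i ⊆ dirRect (e i) (c i) (l i) (L i)) (hw : Measurable w)
    (hw0 : ∫⁻ z, w z ≠ 0) {k : ℝ≥0∞} (hk : k ≠ ⊤) (hwk : ∀ x, w x ≤ k)
    (hfin : ∀ i ∈ T, ∫⁻ z in E i, w z ≠ ⊤) :
    ∫⁻ z, (∑ i ∈ T, (∫⁻ z in E i, w z) / volume (dirRect (e i) (c i) (l i) (L i)) *
        (dirRect (e i) (c i) (l i) (L i)).indicator 1 z) ^ 2 *
          (basisMax volume (IsDirRect N) (basisMax volume IsCube2 w) z)⁻¹ ≤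
      ENNReal.ofReal (6881280000 * Real.log N) * ∑ i ∈ T, ∫⁻ z in E i, w z := by
  set W := basisMax volume (IsDirRect N) (basisMax volume IsCube2 w)
  have hWm : Measurable W := measurable_basisMax (fun R hR ↦ hR.isOpen) _
  set a : ι → ℝ≥0∞ := fun i ↦ ∫⁻ z in E i, w z with ha
  set R : ι → Set (ℝ × ℝ) := fun i ↦ dirRect (e i) (c i) (l i) (L i) with hR
  have hRm : ∀ i, MeasurableSet (R i) := fun i ↦ (isOpen_dirRect _ _ _ _).measurableSet
  set b : ι → ℝ≥0∞ := fun i ↦ a i / volume (R i) with hb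
  set P : ι → ι → ℝ≥0∞ := fun i j ↦ b j * (b i * ∫⁻ z in R i ∩ R j, (W z)⁻¹) with hP
  have hPsymm : ∀ i j, P i j = P j i := fun i j ↦ by
    simp only [hP]
    rw [inter_comm (R i) (R j)]
    ring
  have hexpand : ∫⁻ z, (∑ i ∈ T, b i * (R i).indicator 1 z) ^ 2 * (W z)⁻¹ =
      ∑ j ∈ T, ∑ i ∈ T, P i j := by
    have h1 : ∀ z, (∑ i ∈ T, b i * (R i).indicator 1 z) ^ 2 * (W z)⁻¹ =
        ∑ j ∈ T, ∑ i ∈ T, b j * (b i * (R i ∩ R j).indicator (fun z ↦ (W z)⁻¹) z) := by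
      intro z
      rw [sq, Finset.sum_mul_sum, Finset.sum_mul]
      refine Finset.sum_congr rfl fun j _ ↦ ?_
      rw [Finset.sum_mul]
      refine Finset.sum_congr rfl fun i _ ↦ ?_
      by_cases hi : z ∈ R i <;> by_cases hj : z ∈ R j <;> simp [hi, hj, mul_assoc]
    have hm : ∀ i j, Measurable fun z ↦ (R i ∩ R j).indicator (fun z ↦ (W z)⁻¹) z := fun i j ↦
      hWm.inv.indicator ((hRm i).inter (hRm j))
    simp_rw [h1]
    rw [lintegral_finsetSum _ fun j _ ↦ Finset.measurable_sum _ fun i _ ↦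
      ((hm i j).const_mul _).const_mul _]
    refine Finset.sum_congr rfl fun j _ ↦ ?_
    rw [lintegral_finsetSum _ fun i _ ↦ ((hm i j).const_mul _).const_mul _]
    refine Finset.sum_congr rfl fun i _ ↦ ?_
    rw [lintegral_const_mul _ ((hm i j).const_mul _), lintegral_const_mul _ (hm i j),
      lintegral_indicator ((hRm i).inter (hRm j))]
  set X := ∑ j ∈ T, ∑ i ∈ T with L j ≤ L i, P i j with hX
  have hhalf : ∑ j ∈ T, ∑ i ∈ T, P i j ≤ 2 * X := by
    have h1 : ∀ i j, P i j ≤ (if L j ≤ L i then P i j else 0) +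
        if L i ≤ L j then P i j else 0 := by
      intro i j
      rcases le_total (L j) (L i) with h | h
      · rw [if_pos h]; exact le_add_right le_rfl
      · rw [if_pos h]; exact le_add_left le_rfl
    calc _ ≤ ∑ j ∈ T, ∑ i ∈ T, ((if L j ≤ L i then P i j else 0) +
          if L i ≤ L j then P i j else 0) :=
          Finset.sum_le_sum fun j _ ↦ Finset.sum_le_sum fun i _ ↦ h1 i j
      _ = X + ∑ j ∈ T, ∑ i ∈ T, (if L i ≤ L j then P i j else 0) := by
          simp only [Finset.sum_add_distrib, hX, Finset.sum_filter]
      _ = 2 * X := by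
          rw [Finset.sum_comm, two_mul]
          congr 1
          simp only [hX, Finset.sum_filter]
          refine Finset.sum_congr rfl fun j _ ↦ Finset.sum_congr rfl fun i _ ↦ ?_
          rw [hPsymm]
  have hq := two_le_log hN
  have hqr : (Real.conjExponent (Real.log N)).HolderConjugate (Real.log N) :=
    (Real.HolderConjugate.conjExponent (by linarith)).symm
  have hdir : X ≤ ENNReal.ofReal (573440000 * Real.log N) * (6 * ∑ i ∈ T, a i) := by
    calc X = ∑ d ∈ T.image e, ∑ j ∈ T, b j * ∑ i ∈ T with e i = d ∧ L j ≤ L i,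
          b i * ∫⁻ z in R i ∩ R j, (W z)⁻¹ := by
          rw [Finset.sum_comm]
          refine Finset.sum_congr rfl fun j _ ↦ ?_
          rw [← Finset.mul_sum, ← Finset.mul_sum]
          congr 1
          rw [← Finset.sum_fiberwise_of_maps_to (t := T.image e) (g := e) fun i hi ↦
            Finset.mem_image_of_mem e (Finset.mem_filter.1 hi).1]
          refine Finset.sum_congr rfl fun d _ ↦ ?_
          rw [Finset.filter_filter]
          simp only [and_comm]
      _ ≤ ∑ d ∈ T.image e, ENNReal.ofReal (573440000 * Real.log N) *
          ((∑ i ∈ T, a i) ^ (1 / Real.log N) *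
            (∑ i ∈ T with e i = d, a i) ^ (1 / Real.conjExponent (Real.log N))) := by
          refine Finset.sum_le_sum fun d hd ↦ ?_
          obtain ⟨i, hi, rfl⟩ := Finset.mem_image.1 hd
          exact direction_sum_le he hl hlL hEm hEd hE hw hw0 hk hwk (he i hi) hqr hq hfin
      _ ≤ _ := by
          rw [← Finset.mul_sum]
          exact mul_le_mul_right (sum_rpow_log_le hN he a hqr) _
  calc _ = ∑ j ∈ T, ∑ i ∈ T, P i j := hexpand
    _ ≤ 2 * (ENNReal.ofReal (573440000 * Real.log N) * (6 * ∑ i ∈ T, a i)) :=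
        hhalf.trans (mul_le_mul_right hdir _)
    _ = _ := by
        rw [show 6881280000 * Real.log N = 12 * (573440000 * Real.log N) by ring,
          ENNReal.ofReal_mul (p := 12) (by norm_num)]
        simp only [ENNReal.ofReal_ofNat]
        ring

end Overlap

section WeakType

/-- The constant in the weak type `(2, 2)` estimate. -/
def weakConst (N : ℕ) : ℝ≥0∞ := ENNReal.ofReal (6881280000 * Real.log N)

theorem weakConst_ne_top (N : ℕ) : weakConst N ≠ ⊤ := ENNReal.ofReal_ne_top

variable {N : ℕ} {w f : ℝ × ℝ → ℝ≥0∞}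

theorem basisMax_isDirRect_ne_zero (hN : 0 < N) {v : ℝ × ℝ → ℝ≥0∞} (hv : Measurable v)
    (hv0 : ∀ x, v x ≠ 0) (x : ℝ × ℝ) : basisMax volume (IsDirRect N) v x ≠ 0 := by
  have hd : ((1 : ℝ), (0 : ℝ)) ∈ SigmaN N := ⟨0, hN, by simp⟩
  set R := dirRect (1, 0) x 1 1 with hR
  have hRN : IsDirRect N R := ⟨_, hd, x, 1, 1, one_pos, le_rfl, rfl⟩
  have hxR : x ∈ R := by simp [hR, dirRect]
  have hvol : volume R = 1 := by rw [hR, volume_dirRect (by norm_num)]; simp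
  have h := le_basisMax (m := volume) (g := v) hRN hxR
  rw [hvol, div_one] at h
  intro h0
  rw [h0, nonpos_iff_eq_zero, setLIntegral_eq_zero_iff hRN.isOpen.measurableSet hv] at h
  have h1 : volume R = 0 := measure_mono_null (fun y hy ↦ fun h2 ↦ hv0 y (h2 hy)) h
  rw [hvol] at h1
  exact one_ne_zero h1

theorem sq_lintegral_mul_le {g W : ℝ × ℝ → ℝ≥0∞} (hf : Measurable f) (hg : Measurable g)
    (hW : Measurable W) (hW0 : ∀ x, W x ≠ 0) (hWt : ∀ x, W x ≠ ⊤) :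
    (∫⁻ z, f z * g z) ^ 2 ≤ (∫⁻ z, f z ^ (2 : ℝ) * W z) * ∫⁻ z, g z ^ 2 * (W z)⁻¹ := by
  have h := ENNReal.lintegral_mul_le_Lp_mul_Lq volume Real.HolderConjugate.two_two
    (f := fun z ↦ f z * W z ^ (1 / 2 : ℝ)) (g := fun z ↦ g z * (W z)⁻¹ ^ (1 / 2 : ℝ))
    (hf.mul (hW.pow_const _)).aemeasurable (hg.mul (hW.inv.pow_const _)).aemeasurable
  have hpt : ∀ x y : ℝ≥0∞, (x * y ^ (1 / 2 : ℝ)) ^ (2 : ℝ) = x ^ (2 : ℝ) * y := fun x y ↦ by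
    rw [ENNReal.mul_rpow_of_nonneg _ _ (by norm_num), ← ENNReal.rpow_mul]
    norm_num
  have e1 : ∫⁻ z, ((fun z ↦ f z * W z ^ (1 / 2 : ℝ)) *
      fun z ↦ g z * (W z)⁻¹ ^ (1 / 2 : ℝ)) z = ∫⁻ z, f z * g z := by
    refine lintegral_congr fun z ↦ ?_
    calc f z * W z ^ (1 / 2 : ℝ) * (g z * (W z)⁻¹ ^ (1 / 2 : ℝ))
        = f z * g z * (W z * (W z)⁻¹) ^ (1 / 2 : ℝ) := by
          rw [ENNReal.mul_rpow_of_nonneg _ _ (by norm_num)]; ring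
      _ = f z * g z := by
          rw [ENNReal.mul_inv_cancel (hW0 z) (hWt z), ENNReal.one_rpow, mul_one]
  rw [e1] at h
  simp only [hpt] at h
  calc (∫⁻ z, f z * g z) ^ 2 ≤ _ := pow_le_pow_left' h 2
    _ = _ := by
        rw [mul_pow, ← ENNReal.rpow_natCast, ← ENNReal.rpow_natCast, ← ENNReal.rpow_mul,
          ← ENNReal.rpow_mul]
        norm_num

theorem rpow_two_mul_measure_le (hN : 10 < N) (hw : Measurable w) (hw0 : ∫⁻ z, w z ≠ 0)
    {k : ℝ≥0∞} (hk : k ≠ ⊤) (hwk : ∀ x, w x ≤ k) (hf : Measurable f) {t : ℝ≥0∞} {n : ℕ}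
    {R : ℕ → Set (ℝ × ℝ)}
    (h : ∀ i < n, IsDirRect N (R i) ∧ t < (∫⁻ y in R i, f y) / volume (R i)) :
    t ^ 2 * volume.withDensity w (⋃ i ∈ Finset.range n, R i) ≤
      weakConst N * ∫⁻ z, f z ^ (2 : ℝ) *
        basisMax volume (IsDirRect N) (basisMax volume IsCube2 w) z := by
  have hB : ∀ R : Set (ℝ × ℝ), IsCube2 R → IsOpen R := fun R hR ↦ hR.isOpen
  have hBD : ∀ R : Set (ℝ × ℝ), IsDirRect N R → IsOpen R := fun R hR ↦ hR.isOpen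
  set W := basisMax volume (IsDirRect N) (basisMax volume IsCube2 w) with hWdef
  have hWm : Measurable W := measurable_basisMax hBD _
  have hW0 : ∀ x, W x ≠ 0 := basisMax_isDirRect_ne_zero (by omega)
    (measurable_basisMax hB _) (basisMax_isCube2_ne_zero hw0)
  have hWt : ∀ x, W x ≠ ⊤ := fun x ↦
    ne_top_of_le_ne_top hk (basisMax_le_of_le (basisMax_le_of_le hwk) x)
  have hR := fun i hi ↦ (h i hi).1
  unfold IsDirRect at hR
  choose! e he c l L hl hlL hRe using hR
  set T := Finset.range n
  set E : ℕ → Set (ℝ × ℝ) := fun i ↦ R i \ ⋃ j ∈ Finset.range i, R j with hEdef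
  have hRm : ∀ i ∈ T, MeasurableSet (R i) := fun i hi ↦
    (h i (Finset.mem_range.1 hi)).1.isOpen.measurableSet
  have hEm : ∀ i ∈ T, MeasurableSet (E i) := fun i hi ↦
    (hRm i hi).diff (Finset.measurableSet_biUnion _ fun j hj ↦ hRm j
      (Finset.mem_range.2 ((Finset.mem_range.1 hj).trans (Finset.mem_range.1 hi))))
  have hEd : (T : Set ℕ).PairwiseDisjoint E := by
    have key : ∀ i j, i < j → Disjoint (E i) (E j) := fun i j hij ↦
      disjoint_left.2 fun z hz hz' ↦ hz'.2 (mem_biUnion (Finset.mem_range.2 hij) hz.1)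
    intro i _ j _ hij
    rcases lt_or_gt_of_ne hij with h' | h'
    · exact key i j h'
    · exact (key j i h').symm
  have hER : ∀ i, E i ⊆ R i := fun i ↦ sdiff_subset
  have hEU : ⋃ i ∈ T, E i = ⋃ i ∈ T, R i := by
    refine Subset.antisymm (iUnion₂_mono fun i _ ↦ hER i) fun z hz ↦ ?_
    classical
    obtain ⟨i, hi, hzi⟩ := mem_iUnion₂.1 hz
    have hex : ∃ i, z ∈ R i := ⟨i, hzi⟩
    refine mem_iUnion₂.2 ⟨Nat.find hex, ?_, Nat.find_spec hex, fun hz' ↦ ?_⟩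
    · exact Finset.mem_range.2 ((Nat.find_min' hex hzi).trans_lt (Finset.mem_range.1 hi))
    · obtain ⟨j, hj, hzj⟩ := mem_iUnion₂.1 hz'
      exact Nat.find_min hex (Finset.mem_range.1 hj) hzj
  have hvol : ∀ i ∈ T, volume (R i) = ENNReal.ofReal (L i) * ENNReal.ofReal (l i) := by
    intro i hi
    have hi' := Finset.mem_range.1 hi
    rw [hRe i hi', volume_dirRect (norm_sq_of_mem_SigmaN (he i hi'))]
  have hvt : ∀ i ∈ T, volume (R i) ≠ ⊤ := fun i hi ↦ by
    rw [hvol i hi]; exact ENNReal.mul_ne_top ENNReal.ofReal_ne_top ENNReal.ofReal_ne_top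
  have hv0 : ∀ i ∈ T, volume (R i) ≠ 0 := fun i hi ↦ by
    have h1 := hl i (Finset.mem_range.1 hi)
    have h2 := hlL i (Finset.mem_range.1 hi)
    rw [hvol i hi]
    exact mul_ne_zero (by simpa using h1.trans_le h2) (by simpa using h1)
  set a : ℕ → ℝ≥0∞ := fun i ↦ ∫⁻ z in E i, w z with ha
  have hfin : ∀ i ∈ T, a i ≠ ⊤ := by
    intro i hi
    refine ne_top_of_le_ne_top (ENNReal.mul_ne_top hk (hvt i hi)) ?_
    calc a i ≤ ∫⁻ z in R i, w z := lintegral_mono_set (hER i)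
      _ ≤ ∫⁻ _ in R i, k := lintegral_mono hwk
      _ = _ := setLIntegral_const _ _
  set A := ∑ i ∈ T, a i with hA
  have hAt : A ≠ ⊤ := ENNReal.sum_ne_top.2 hfin
  have hμ : volume.withDensity w (⋃ i ∈ T, R i) = A := by
    rw [withDensity_apply _ (Finset.measurableSet_biUnion _ hRm), ← hEU,
      lintegral_biUnion_finset hEd hEm]
  set g : ℝ × ℝ → ℝ≥0∞ := fun z ↦ ∑ i ∈ T, a i / volume (R i) * (R i).indicator 1 z with hg
  have hRi : ∀ i ∈ T, Measurable fun z ↦ a i / volume (R i) * (R i).indicator 1 z := fun i hi ↦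
    (measurable_one.indicator (hRm i hi)).const_mul _
  have hgm : Measurable g := Finset.measurable_sum _ hRi
  have hdual : t * A ≤ ∫⁻ z, f z * g z := by
    have h1 : ∀ z, f z * g z = ∑ i ∈ T, a i / volume (R i) * (R i).indicator f z := by
      intro z
      rw [hg, Finset.mul_sum]
      refine Finset.sum_congr rfl fun i _ ↦ ?_
      by_cases hz : z ∈ R i <;> simp [hz, mul_comm]
    simp_rw [h1]
    rw [lintegral_finsetSum' _ fun i hi ↦ ((hf.indicator (hRm i hi)).const_mul _).aemeasurable,
      hA, Finset.mul_sum]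
    refine Finset.sum_le_sum fun i hi ↦ ?_
    rw [lintegral_const_mul _ (hf.indicator (hRm i hi)), lintegral_indicator (hRm i hi)]
    calc t * a i ≤ (∫⁻ y in R i, f y) / volume (R i) * a i := by
          gcongr
          exact (h i (Finset.mem_range.1 hi)).2.le
      _ = _ := by rw [div_eq_mul_inv, div_eq_mul_inv]; ring
  have hsq : ∫⁻ z, g z ^ 2 * (W z)⁻¹ ≤ weakConst N * A := by
    have := lintegral_sum_indicator_sq_le (T := T) (e := e) (c := c) (l := l) (L := L) (E := E)
      hN (fun i hi ↦ he i (Finset.mem_range.1 hi)) (fun i hi ↦ hl i (Finset.mem_range.1 hi))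
      (fun i hi ↦ hlL i (Finset.mem_range.1 hi)) hEm hEd
      (fun i hi ↦ (hER i).trans (hRe i (Finset.mem_range.1 hi)).le) hw hw0 hk hwk hfin
    refine le_of_eq_of_le (lintegral_congr fun z ↦ ?_) this
    congr 2
    refine Finset.sum_congr rfl fun i hi ↦ ?_
    rw [← hRe i (Finset.mem_range.1 hi)]
  rw [hμ]
  set Y := ∫⁻ z, f z ^ (2 : ℝ) * W z
  rcases eq_or_ne A 0 with h0 | h0
  · rw [h0, mul_zero]; exact zero_le
  refine (ENNReal.mul_le_mul_iff_left h0 hAt).1 ?_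
  calc t ^ 2 * A * A = (t * A) ^ 2 := by ring
    _ ≤ (∫⁻ z, f z * g z) ^ 2 := pow_le_pow_left' hdual 2
    _ ≤ Y * ∫⁻ z, g z ^ 2 * (W z)⁻¹ := sq_lintegral_mul_le hf hgm hWm hW0 hWt
    _ ≤ Y * (weakConst N * A) := mul_le_mul_right hsq _
    _ = _ := by ring

end WeakType

section StrongType

variable {N : ℕ} {w : ℝ × ℝ → ℝ≥0∞}

theorem lintegral_basisMax_isDirRect_rpow_le_of_bounded (hN : 10 < N) (hw : Measurable w)
    {k : ℝ≥0∞} (hk : k ≠ ⊤) (hwk : ∀ x, w x ≤ k) {p : ℝ} (hp : 2 < p) {h : ℝ × ℝ → ℝ≥0∞}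
    (hh : Measurable h) :
    ∫⁻ x, basisMax volume (IsDirRect N) h x ^ p * w x ≤
      weakConst N * ENNReal.ofReal (p / (p - 2) * 2 ^ p) *
        ∫⁻ x, h x ^ p * basisMax volume (IsDirRect N) (basisMax volume IsCube2 w) x := by
  have hBD : ∀ R : Set (ℝ × ℝ), IsDirRect N R → IsOpen R := fun R hR ↦ hR.isOpen
  set W := basisMax volume (IsDirRect N) (basisMax volume IsCube2 w)
  have hWm : Measurable W := measurable_basisMax hBD _
  by_cases hw0 : ∫⁻ z, w z = 0
  · refine le_of_eq_of_le ?_ zero_le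
    rw [lintegral_eq_zero_iff hw] at hw0
    refine lintegral_eq_zero_of_ae_eq_zero ?_
    filter_upwards [hw0] with x hx
    simp only [hx, Pi.zero_apply, mul_zero]
  have hdens : ∀ {u F : ℝ × ℝ → ℝ≥0∞}, Measurable u → Measurable F → ∀ s : ℝ,
      ∫⁻ x, F x ^ s ∂(volume.withDensity u) = ∫⁻ x, F x ^ s * u x := by
    intro u F hu hF s
    rw [lintegral_withDensity_eq_lintegral_mul _ hu (hF.pow_const s)]
    simp only [Pi.mul_apply, mul_comm]
  have := lintegral_basisMax_rpow_le (m := volume) (μ := volume.withDensity w)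
    (ν := volume.withDensity W) hBD two_pos hp (weakConst_ne_top N) (fun g hg t ht ↦ ?_) hh
  · rwa [hdens hw (measurable_basisMax hBD h), hdens hWm hh] at this
  · have ht0 : ENNReal.ofReal (t ^ (2 : ℝ)) ≠ 0 := by simp; positivity
    rw [hdens hWm hg, mul_comm]
    refine ENNReal.mul_le_of_le_div (measure_lt_basisMax_le hBD fun n R hR ↦ ?_)
    rw [ENNReal.le_div_iff_mul_le (Or.inl ht0) (Or.inl ENNReal.ofReal_ne_top), mul_comm]
    refine le_of_eq_of_le ?_ (rpow_two_mul_measure_le hN hw hw0 hk hwk hg hR)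
    rw [Real.rpow_two, ENNReal.ofReal_pow ht.le]

theorem lintegral_basisMax_isDirRect_rpow_le (hN : 10 < N) (hw : Measurable w) {p : ℝ}
    (hp : 2 < p) {h : ℝ × ℝ → ℝ≥0∞} (hh : Measurable h) :
    ∫⁻ x, basisMax volume (IsDirRect N) h x ^ p * w x ≤
      weakConst N * ENNReal.ofReal (p / (p - 2) * 2 ^ p) *
        ∫⁻ x, h x ^ p * basisMax volume (IsDirRect N) (basisMax volume IsCube2 w) x := by
  have hBD : ∀ R : Set (ℝ × ℝ), IsDirRect N R → IsOpen R := fun R hR ↦ hR.isOpen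
  have hF : Measurable fun x ↦ basisMax volume (IsDirRect N) h x ^ p :=
    (measurable_basisMax hBD h).pow_const p
  have hsup : ∀ x, w x = ⨆ n : ℕ, min (w x) n := by
    intro x
    rw [← inf_iSup_eq, ENNReal.iSup_natCast, inf_top_eq]
  have hm : ∀ n : ℕ, Measurable fun x ↦
      basisMax volume (IsDirRect N) h x ^ p * min (w x) n := fun n ↦
    hF.mul (hw.min measurable_const)
  have hmono : Monotone fun (n : ℕ) x ↦ basisMax volume (IsDirRect N) h x ^ p * min (w x) n := by
    intro m n hmn x
    dsimp only
    gcongr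
  calc ∫⁻ x, basisMax volume (IsDirRect N) h x ^ p * w x
      = ⨆ n : ℕ, ∫⁻ x, basisMax volume (IsDirRect N) h x ^ p * min (w x) n := by
        rw [← lintegral_iSup hm hmono]
        refine lintegral_congr fun x ↦ ?_
        rw [← ENNReal.mul_iSup, ← hsup]
    _ ≤ _ := by
        refine iSup_le fun n ↦ (lintegral_basisMax_isDirRect_rpow_le_of_bounded hN
          (hw.min measurable_const) (ENNReal.natCast_ne_top n) (fun x ↦ min_le_right _ _) hp
            hh).trans ?_
        gcongr with x
        exact basisMax_mono (basisMax_mono fun y ↦ min_le_left _ _) x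

theorem basisMax_congr {α : Type*} [MeasurableSpace α] {m : Measure α} {B : Set α → Prop}
    {g g' : α → ℝ≥0∞} (h : ∀ R, B R → ∫⁻ y in R, g y ∂m = ∫⁻ y in R, g' y ∂m) :
    basisMax m B g = basisMax m B g' := by
  funext x
  unfold basisMax
  refine iSup_congr fun R ↦ iSup_congr fun hR ↦ ?_
  rw [h R hR.1]

end StrongType

/-- `L^p` bound (`p > 2`) for the directional maximal operator with `N` uniformly
spread directions, with majorant `W = M_{Σ_N} M_Q w`. -/
theorem directional_Lp (p : ℝ) (hp2 : 2 < p) :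
    ∃ C : ℝ, 0 < C ∧
      ∀ N : ℕ, 10 < N →
        ∀ (w f : ℝ × ℝ → ℝ), (∀ x, 0 ≤ w x) → LocallyIntegrable w volume →
          (∫⁻ x, ENNReal.ofReal (|f x| ^ p) * MSigE N (MHL2 w) x) < ⊤ →
            (∫⁻ x, (MSig N f x) ^ p * ENNReal.ofReal (w x)) ^ (1 / p) ≤
              ENNReal.ofReal C * ENNReal.ofReal (Real.log N) ^ (1 / p) *
                (∫⁻ x, ENNReal.ofReal (|f x| ^ p) * MSigE N (MHL2 w) x) ^ (1 / p) := by
  have hp0 : 0 < p := by linarith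
  have hc : 0 < p / (p - 2) * 2 ^ p :=
    mul_pos (div_pos hp0 (by linarith)) (Real.rpow_pos_of_pos two_pos p)
  set B : ℝ := 6881280000 * (p / (p - 2) * 2 ^ p) with hB
  have hB0 : 0 < B := by positivity
  refine ⟨B ^ (1 / p), Real.rpow_pos_of_pos hB0 _, fun N hN w f hw hwi _ ↦ ?_⟩
  have hlog : 0 ≤ Real.log N := by linarith [two_le_log hN]
  have hwm : AEMeasurable (fun x ↦ ENNReal.ofReal (w x)) :=
    hwi.aestronglyMeasurable.aemeasurable.ennreal_ofReal
  set w' := hwm.mk with hw'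
  have hwae : (fun x ↦ ENNReal.ofReal (w x)) =ᵐ[volume] w' := hwm.ae_eq_mk
  have hW : MSigE N (MHL2 w) = basisMax volume (IsDirRect N) (basisMax volume IsCube2 w') := by
    have h1 : MHL2 w = basisMax volume IsCube2 w' := by
      refine basisMax_congr (g := fun x ↦ ENNReal.ofReal |w x|) fun R _ ↦ ?_
      simp_rw [abs_of_nonneg (hw _)]
      exact lintegral_congr_ae (ae_restrict_of_ae hwae)
    rw [h1]
    rfl
  obtain ⟨g, hg, hgf, hgeq⟩ := exists_measurable_le_forall_setLIntegral_eq volume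
    fun x ↦ ENNReal.ofReal |f x|
  have hM : MSig N f = basisMax volume (IsDirRect N) g :=
    basisMax_congr (g := fun x ↦ ENNReal.ofReal |f x|) fun R hR ↦ hgeq R
  have hmain : ∫⁻ x, (MSig N f x) ^ p * ENNReal.ofReal (w x) ≤
      ENNReal.ofReal B * ENNReal.ofReal (Real.log N) *
        ∫⁻ x, ENNReal.ofReal (|f x| ^ p) * MSigE N (MHL2 w) x := by
    calc ∫⁻ x, (MSig N f x) ^ p * ENNReal.ofReal (w x)
        = ∫⁻ x, basisMax volume (IsDirRect N) g x ^ p * w' x := by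
          rw [hM]
          refine lintegral_congr_ae ?_
          filter_upwards [hwae] with x hx
          rw [← hx]
      _ ≤ weakConst N * ENNReal.ofReal (p / (p - 2) * 2 ^ p) *
          ∫⁻ x, g x ^ p * basisMax volume (IsDirRect N) (basisMax volume IsCube2 w') x :=
          lintegral_basisMax_isDirRect_rpow_le hN hwm.measurable_mk hp2 hg
      _ ≤ _ := by
          rw [hW]
          refine mul_le_mul' (le_of_eq ?_) (lintegral_mono fun x ↦ ?_)
          · rw [weakConst, ← ENNReal.ofReal_mul (by positivity), ← ENNReal.ofReal_mul hB0.le, hB]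
            congr 1
            ring
          · dsimp only
            gcongr
            rw [← ENNReal.ofReal_rpow_of_nonneg (abs_nonneg _) hp0.le]
            exact ENNReal.rpow_le_rpow (hgf x) hp0.le
  refine (ENNReal.rpow_le_rpow hmain (by positivity)).trans_eq ?_
  rw [ENNReal.mul_rpow_of_nonneg _ _ (by positivity), ENNReal.mul_rpow_of_nonneg _ _ (by positivity),
    ENNReal.ofReal_rpow_of_nonneg hB0.le (by positivity)]
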